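/- Let (G, S, R, v, P_k(v), Q, k) be a minimal counterexample to the Extension Theorem with k ≥ 8, let W be the set of neighbors of v that are not in S ∪ R, and let G' = G − v − W. Then (S ∪ R) − {v} is at most (⌊5.5k⌋ − 1)-edge-connected in G', i.e., (S ∪ R) − {v} is not ⌊5.5k⌋-edge-connected in G'. -/

import Mathlib

/-!
Multigraphs are modelled by a vertex type `V`, an edge type `E`, and an
incidence map `ends : E → Sym2 V` giving the (unordered) pair of endpoints
of each edge.  Subgraphs are identified with their edge sets (`Set E`).
-/

namespace SteinerPacking

variable {V E : Type}

/-- The set of edges incident to a vertex `u` (denoted `E(u)` in the paper). -/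
def incEdges (ends : E → Sym2 V) (u : V) : Set E := {e | u ∈ ends e}

/-- The degree `d(u) = |E(u)|` of a vertex. -/
noncomputable def deg (ends : E → Sym2 V) (u : V) : ℕ := (incEdges ends u).ncard

/-- One step along an edge of the edge set `F`. -/
def Step (ends : E → Sym2 V) (F : Set E) (a b : V) : Prop := ∃ e ∈ F, ends e = s(a, b)

/-- `a` and `b` are joined by a walk using only edges in `F`. -/
def Reaches (ends : E → Sym2 V) (F : Set E) (a b : V) : Prop :=
  Relation.ReflTransGen (Step ends F) a b

/-- The vertex set `S` is connected in the subgraph with edge set `F`. -/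
def ConnectsSet (ends : E → Sym2 V) (F : Set E) (S : Set V) : Prop :=
  ∀ a ∈ S, ∀ b ∈ S, Reaches ends F a b

/-- A walk from `u` to `w` given by a list of edges. -/
inductive IsWalk (ends : E → Sym2 V) : V → V → List E → Prop
  | nil (v : V) : IsWalk ends v v []
  | cons {u v w : V} {e : E} {l : List E} :
      ends e = s(u, v) → IsWalk ends v w l → IsWalk ends u w (e :: l)

/-- A path from `u` to `v` using edges of `F` (a walk with no repeated edges). -/
def IsPathIn (ends : E → Sym2 V) (F : Set E) (u v : V) (l : List E) : Prop :=
  IsWalk ends u v l ∧ l.Nodup ∧ ∀ e ∈ l, e ∈ F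

/-- There are `n` pairwise edge-disjoint paths from `u` to `v` inside `F`. -/
def EdgeDisjointPathsIn (ends : E → Sym2 V) (F : Set E) (n : ℕ) (u v : V) : Prop :=
  ∃ P : Fin n → List E, (∀ i, IsPathIn ends F u v (P i)) ∧
    ∀ i j, i ≠ j → ∀ e ∈ P i, e ∉ P j

/-- `S` is `n`-edge-connected in the (sub)graph with edge set `F`:
any two distinct vertices of `S` are joined by `n` edge-disjoint paths. -/
def EdgeConnectedIn (ends : E → Sym2 V) (F : Set E) (S : Set V) (n : ℕ) : Prop :=
  ∀ a ∈ S, ∀ b ∈ S, a ≠ b → EdgeDisjointPathsIn ends F n a b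

/-- A family of subgraphs (edge sets) is pairwise edge-disjoint. -/
def PairwiseEdgeDisjoint {k : ℕ} (H : Fin k → Set E) : Prop :=
  ∀ i j, i ≠ j → Disjoint (H i) (H j)

/-- `v` is a cut vertex of the subgraph with edge set `H`: some two vertices
distinct from `v` are connected in `H` but not after removing `v`. -/
def IsCutVertexOf (ends : E → Sym2 V) (H : Set E) (v : V) : Prop :=
  ∃ a b : V, a ≠ v ∧ b ≠ v ∧ Reaches ends H a b ∧
    ¬ Reaches ends {e ∈ H | v ∉ ends e} a b

/-- A subpartition of `E(v)` into `k` (possibly empty) parts. -/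
def IsSubpartitionAt {k : ℕ} (ends : E → Sym2 V) (v : V) (P : Fin k → Set E) : Prop :=
  (∀ i, P i ⊆ incEdges ends v) ∧ ∀ i j, i ≠ j → Disjoint (P i) (P j)

/-- A balanced partition of `E(v)` into `k` parts: each part has ≥ 2 edges. -/
def IsBalancedPartitionAt {k : ℕ} (ends : E → Sym2 V) (v : V) (P : Fin k → Set E) : Prop :=
  IsSubpartitionAt ends v P ∧ (⋃ i, P i) = incEdges ends v ∧ ∀ i, 2 ≤ (P i).ncard

/-- A balanced subpartition of `E(v)`: one extendable to a balanced partition. -/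
def IsBalancedSubpartitionAt {k : ℕ} (ends : E → Sym2 V) (v : V) (P : Fin k → Set E) : Prop :=
  IsSubpartitionAt ends v P ∧
    ∃ P' : Fin k → Set E, IsBalancedPartitionAt ends v P' ∧ ∀ i, P i ⊆ P' i

/-- The subgraphs `H 1, …, H k` extend the subpartition `P` at `v`:
`P i ⊆ H i` and `v` is not a cut vertex of any `H i`. -/
def Extend {k : ℕ} (ends : E → Sym2 V) (v : V) (P H : Fin k → Set E) : Prop :=
  ∀ i, P i ⊆ H i ∧ ¬ IsCutVertexOf ends (H i) v

/-- The subgraphs `H 1, …, H k` balance the vertex `u`. -/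
def BalanceVertex {k : ℕ} (ends : E → Sym2 V) (H : Fin k → Set E) (u : V) : Prop :=
  IsBalancedSubpartitionAt ends u (fun i => incEdges ends u ∩ H i)

/-- The subgraphs `H 1, …, H k` balance every vertex of `T`. -/
def BalanceSet {k : ℕ} (ends : E → Sym2 V) (H : Fin k → Set E) (T : Set V) : Prop :=
  ∀ u ∈ T, BalanceVertex ends H u

/-- A loopless multigraph. -/
def Loopless (ends : E → Sym2 V) : Prop := ∀ e : E, ¬ (ends e).IsDiag

/-- The set of neighbors of a vertex. -/
def neighbors (ends : E → Sym2 V) (u : V) : Set V := {w | ∃ e, ends e = s(u, w)}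

/-- There is no family of `k` pairwise edge-disjoint `S`-subgraphs that
balance `S ∪ R` and extend the subpartition `P` at `v`. -/
def NoGoodPacking {k : ℕ} (ends : E → Sym2 V) (S R : Set V) (v : V)
    (P : Fin k → Set E) : Prop :=
  ¬ ∃ H : Fin k → Set E, PairwiseEdgeDisjoint H ∧ (∀ i, ConnectsSet ends (H i) S) ∧
      BalanceSet ends H (S ∪ R) ∧ Extend ends v P H

/-- `(G, S, R, v, P, Q, k)` is a counterexample to the Extension Theorem:
it satisfies all hypotheses of the Extension Theorem (including that every
label appears at least twice at `v`), yet admits no good packing. -/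
def ExtCex (Q k : ℕ) (ends : E → Sym2 V) (S R : Set V) (v : V)
    (P : Fin k → Set E) : Prop :=
  36 ≤ Q ∧ 0 < k ∧ Disjoint S R ∧ 2 ≤ S.ncard ∧
  EdgeConnectedIn ends Set.univ S (Q * k) ∧
  (∀ r ∈ R, (Q - 2) * k ≤ deg ends r) ∧
  v ∈ S ∧ (∀ e : E, v ∈ ends e → ¬ (ends e).IsDiag) ∧
  deg ends v = Q * k ∧
  IsBalancedSubpartitionAt ends v P ∧ (∀ i, 2 ≤ (P i).ncard) ∧
  NoGoodPacking ends S R v P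

/-- The measure used for minimality: number of vertices plus number of
non-loop edges. -/
noncomputable def extMeasure (ends : E → Sym2 V) : ℕ :=
  Nat.card V + {e : E | ¬ (ends e).IsDiag}.ncard

/-- A minimal counterexample to the Extension Theorem: a counterexample whose
measure is at most the measure of every counterexample (with the same `Q`, `k`). -/
def MinExtCex (Q k : ℕ) (ends : E → Sym2 V) (S R : Set V) (v : V)
    (P : Fin k → Set E) : Prop :=
  ExtCex Q k ends S R v P ∧
  ∀ (V' E' : Type) (_ : Finite V') (_ : Finite E') (ends' : E' → Sym2 V')
    (S' R' : Set V') (v' : V') (P' : Fin k → Set E'),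
    ExtCex Q k ends' S' R' v' P' → extMeasure ends ≤ extMeasure ends'

/-- The number of arcs of `D` entering the vertex set `X`. -/
def arcsInto {α ι : Type} [DecidableEq α] (tail head : ι → α) (D : Finset ι) (X : Finset α) : ℕ :=
  (D.filter fun i => head i ∈ X ∧ tail i ∉ X).card

section Arborescences

variable {α ι : Type} [DecidableEq α]

lemma arcsInto_submodular (tail head : ι → α) (D : Finset ι) (X Y : Finset α) :
    arcsInto tail head D (X ∩ Y) + arcsInto tail head D (X ∪ Y) ≤
      arcsInto tail head D X + arcsInto tail head D Y := by
  simp only [arcsInto, Finset.card_filter, ← Finset.sum_add_distrib]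
  refine Finset.sum_le_sum fun i _ => ?_
  by_cases h1 : head i ∈ X <;> by_cases h2 : head i ∈ Y <;> by_cases h3 : tail i ∈ X <;>
    by_cases h4 : tail i ∈ Y <;> simp [h1, h2, h3, h4]

lemma arcsInto_sdiff_singleton [DecidableEq ι] (tail head : ι → α) (D : Finset ι)
    (X : Finset α) (i : ι) :
    arcsInto tail head D X ≤ arcsInto tail head (D \ {i}) X +
      if head i ∈ X ∧ tail i ∉ X then 1 else 0 := by
  unfold arcsInto
  by_cases hi : head i ∈ X ∧ tail i ∉ X
  · rw [if_pos hi]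
    have : D.filter (fun i => head i ∈ X ∧ tail i ∉ X) ⊆
        insert i ((D \ {i}).filter (fun i => head i ∈ X ∧ tail i ∉ X)) := by
      intro j hj
      simp only [Finset.mem_filter, Finset.mem_insert, Finset.mem_sdiff,
        Finset.mem_singleton] at hj ⊢
      tauto
    exact (Finset.card_le_card this).trans (Finset.card_insert_le _ _)
  · rw [if_neg hi, add_zero]
    refine Finset.card_le_card fun j hj => ?_
    simp only [Finset.mem_filter, Finset.mem_sdiff, Finset.mem_singleton] at hj ⊢
    refine ⟨⟨hj.1, ?_⟩, hj.2⟩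
    rintro rfl
    exact hi hj.2

/-- Lovász's lemma: a rooted `(k+1)`-connected digraph has a spanning arborescence whose
removal leaves a rooted `k`-connected digraph. -/
lemma exists_arborescence [DecidableEq ι] [Fintype α] (tail head : ι → α) (r : α) (k : ℕ)
    (D : Finset ι)
    (hD : ∀ X : Finset α, X.Nonempty → r ∉ X → k + 1 ≤ arcsInto tail head D X) :
    ∃ B ⊆ D, (∀ u, Relation.ReflTransGen (fun x y => ∃ i ∈ B, tail i = x ∧ head i = y) r u) ∧
      (∀ u, (B.filter fun i => head i = u).card ≤ 1) ∧
      ∀ X : Finset α, X.Nonempty → r ∉ X → k ≤ arcsInto tail head (D \ B) X := by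
  classical
  let good : Finset α → Prop := fun R => ∃ B ⊆ D, r ∈ R ∧ (∀ i ∈ B, head i ∈ R) ∧
    (∀ u ∈ R, Relation.ReflTransGen (fun x y => ∃ i ∈ B, tail i = x ∧ head i = y) r u) ∧
    (∀ u, (B.filter fun i => head i = u).card ≤ 1) ∧
    ∀ X : Finset α, X.Nonempty → r ∉ X → k ≤ arcsInto tail head (D \ B) X
  have hgood : good {r} := by
    refine ⟨∅, by simp, by simp, by simp, ?_, by simp, fun X hX hr => ?_⟩
    · intro u hu
      rw [Finset.mem_singleton.1 hu]
    · have := hD X hX hr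
      simp only [Finset.sdiff_empty]
      omega
  obtain ⟨R, hR, hmax⟩ := Finset.exists_max_image (Finset.univ.filter good) Finset.card
    ⟨{r}, by simpa using hgood⟩
  obtain ⟨B, hBD, hrR, hBR, hreach, hdeg, hcut⟩ := (Finset.mem_filter.1 hR).2
  by_cases hRu : R = Finset.univ
  · exact ⟨B, hBD, fun u => hreach u (hRu ▸ Finset.mem_univ u), hdeg, hcut⟩
  exfalso
  have key : ∃ i ∈ D \ B, tail i ∈ R ∧ head i ∉ R ∧ ∀ Y : Finset α, r ∉ Y → head i ∈ Y →
      tail i ∉ Y → k + 1 ≤ arcsInto tail head (D \ B) Y := by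
    have hout : ∀ X : Finset α, (∀ x ∈ X, x ∉ R) →
        arcsInto tail head D X ≤ arcsInto tail head (D \ B) X := by
      intro X hX
      refine Finset.card_le_card fun j hj => ?_
      simp only [Finset.mem_filter, Finset.mem_sdiff] at hj ⊢
      exact ⟨⟨hj.1, fun hjB => hX _ hj.2.1 (hBR j hjB)⟩, hj.2⟩
    let crit : Finset α → Prop := fun X =>
      r ∉ X ∧ (X \ R).Nonempty ∧ arcsInto tail head (D \ B) X ≤ k
    by_cases hc : ∃ X, crit X
    · obtain ⟨X, hX, hmin⟩ := Finset.exists_min_image (Finset.univ.filter crit) Finset.card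
        (by obtain ⟨X, hX⟩ := hc; exact ⟨X, by simpa using hX⟩)
      obtain ⟨hrX, hXR, hXk⟩ := (Finset.mem_filter.1 hX).2
      have h1 := hD (X \ R) hXR (by simp [hrX])
      have h2 := hout (X \ R) (by simp)
      have : ∃ i ∈ D \ B, (head i ∈ X \ R ∧ tail i ∉ X \ R) ∧ ¬ (head i ∈ X ∧ tail i ∉ X) := by
        by_contra! hcon
        have : arcsInto tail head (D \ B) (X \ R) ≤ arcsInto tail head (D \ B) X := by
          refine Finset.card_le_card fun j hj => ?_
          simp only [Finset.mem_filter] at hj ⊢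
          exact ⟨hj.1, hcon j hj.1 hj.2⟩
        omega
      obtain ⟨i, hi, ⟨h3, h4⟩, h5⟩ := this
      simp only [Finset.mem_sdiff, not_and, not_not] at h3 h4 h5
      have htX : tail i ∈ X := h5 h3.1
      refine ⟨i, hi, h4 htX, h3.2, fun Y hrY hhY htY => ?_⟩
      by_contra hlt
      have hsub := arcsInto_submodular tail head (D \ B) X Y
      have hun := hcut (X ∪ Y) ⟨_, Finset.mem_union_left _ htX⟩ (by simp [hrX, hrY])
      have hcrit_inter : crit (X ∩ Y) := by
        refine ⟨by simp [hrX], ⟨head i, by simp [h3.1, h3.2, hhY]⟩, by omega⟩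
      have := hmin (X ∩ Y) (by simpa using hcrit_inter)
      have hlt' : (X ∩ Y).card < X.card := Finset.card_lt_card
        ⟨Finset.inter_subset_left, fun h => htY (Finset.mem_inter.1 (h htX)).2⟩
      omega
    · have hne : (Finset.univ \ R).Nonempty := by
        rw [Finset.sdiff_nonempty]
        exact fun h => hRu (Finset.univ_subset_iff.1 h)
      have h1 := hD (Finset.univ \ R) hne (by simp [hrR])
      have h2 := hout (Finset.univ \ R) (by simp)
      obtain ⟨i, hi⟩ : ((D \ B).filter
          fun i => head i ∈ Finset.univ \ R ∧ tail i ∉ Finset.univ \ R).Nonempty := by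
        rw [← Finset.card_pos]
        unfold arcsInto at h1 h2
        omega
      simp only [Finset.mem_filter, Finset.mem_sdiff, Finset.mem_univ, true_and, not_not] at hi
      refine ⟨i, by simp [hi.1], hi.2.2, hi.2.1, fun Y hrY hhY htY => ?_⟩
      by_contra hlt
      exact hc ⟨Y, hrY, ⟨head i, by simp [hhY, hi.2.1]⟩, by omega⟩
  obtain ⟨i, hi, htR, hhR, hiY⟩ := key
  have hiD := Finset.mem_sdiff.1 hi
  have hnew : good (insert (head i) R) := by
    refine ⟨insert i B, Finset.insert_subset hiD.1 hBD, by simp [hrR], ?_, ?_, ?_, ?_⟩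
    · intro j hj
      rcases Finset.mem_insert.1 hj with rfl | hj
      · simp
      · simp [hBR j hj]
    · have hmono : ∀ u ∈ R, Relation.ReflTransGen
          (fun x y => ∃ j ∈ insert i B, tail j = x ∧ head j = y) r u := fun u hu =>
        Relation.ReflTransGen.mono (fun x y ⟨j, hj, h⟩ => ⟨j, Finset.mem_insert_of_mem hj, h⟩) _ _
          (hreach u hu)
      intro u hu
      rcases Finset.mem_insert.1 hu with rfl | hu
      · exact (hmono _ htR).tail ⟨i, by simp, rfl, rfl⟩
      · exact hmono u hu
    · intro u
      rw [Finset.filter_insert]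
      split_ifs with hu
      · have : B.filter (fun j => head j = u) = ∅ := by
          refine Finset.filter_eq_empty_iff.2 fun j hj hju => hhR ?_
          rw [hu, ← hju]
          exact hBR j hj
        simp [this]
      · exact hdeg u
    · intro X hX hrX
      have h1 := arcsInto_sdiff_singleton tail head (D \ B) X i
      have h2 : (D \ B) \ {i} = D \ insert i B := by
        ext j
        simp only [Finset.mem_sdiff, Finset.mem_singleton, Finset.mem_insert]
        tauto
      rw [h2] at h1
      have h3 := hcut X hX hrX
      split_ifs at h1 with h4
      · have := hiY X hrX h4.1 h4.2
        omega
      · omega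
  have := hmax _ (by simpa using hnew)
  rw [Finset.card_insert_of_notMem hhR] at this
  omega

/-- Edmonds' theorem on packing `k` arc-disjoint spanning arborescences. -/
theorem exists_disjoint_arborescences [DecidableEq ι] [Fintype α] (tail head : ι → α) (r : α)
    (k : ℕ) : ∀ D : Finset ι,
    (∀ X : Finset α, X.Nonempty → r ∉ X → k ≤ arcsInto tail head D X) →
    ∃ B : Fin k → Finset ι, (∀ j, B j ⊆ D) ∧ (∀ i j, i ≠ j → Disjoint (B i) (B j)) ∧
      (∀ j u, Relation.ReflTransGen (fun x y => ∃ i ∈ B j, tail i = x ∧ head i = y) r u) ∧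
      ∀ j u, ((B j).filter fun i => head i = u).card ≤ 1 := by
  induction k with
  | zero => exact fun D _ => ⟨fun j => j.elim0, fun j => j.elim0, fun j => j.elim0,
      fun j => j.elim0, fun j => j.elim0⟩
  | succ k ih =>
    intro D hD
    obtain ⟨B, hBD, hreach, hdeg, hcut⟩ := exists_arborescence tail head r k D hD
    obtain ⟨B', hB', hdis, hreach', hdeg'⟩ := ih (D \ B) hcut
    have hBB' : ∀ j, Disjoint B (B' j) := fun j =>
      Finset.disjoint_of_subset_right (hB' j) Finset.disjoint_sdiff
    refine ⟨Fin.cons B B', ?_, ?_, ?_, ?_⟩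
    · intro j
      refine Fin.cases hBD (fun j => (hB' j).trans Finset.sdiff_subset) j
    · intro i j
      refine Fin.cases ?_ (fun i => ?_) i <;> refine Fin.cases ?_ (fun j => ?_) j
      · simp
      · exact fun _ => hBB' j
      · exact fun _ => (hBB' i).symm
      · exact fun h => hdis i j fun h' => h (by rw [h'])
    · intro j
      refine Fin.cases hreach hreach' j
    · intro j
      refine Fin.cases hdeg hdeg' j

end Arborescences

/-- The edges of `F` joining the vertex set `X` to its complement. -/
def cutEdges {V E : Type} (ends : E → Sym2 V) (F : Set E) (X : Set V) : Set E :=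
  {e ∈ F | (∃ x ∈ ends e, x ∈ X) ∧ ∃ y ∈ ends e, y ∉ X}

section Walks

variable {V E : Type} {ends : E → Sym2 V}

lemma IsWalk.exists_suffix {u w : V} {l : List E} {e : E} (h : IsWalk ends u w l) (he : e ∈ l) :
    ∃ x y l', ends e = s(x, y) ∧ IsWalk ends y w l' ∧ (e :: l') <:+ l := by
  induction h with
  | nil => simp at he
  | @cons u v w f l hf hl ih =>
    by_cases hef : e = f
    · subst hef
      exact ⟨u, v, l, hf, hl, List.suffix_rfl⟩
    · obtain ⟨x, y, l', h1, h2, h3⟩ := ih ((List.mem_cons.1 he).resolve_left hef)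
      exact ⟨x, y, l', h1, h2, h3.trans (List.suffix_cons _ _)⟩

lemma Reaches.exists_path {F : Set E} {a b : V} (h : Reaches ends F a b) :
    ∃ l, IsPathIn ends F a b l := by
  induction h using Relation.ReflTransGen.head_induction_on with
  | refl => exact ⟨[], .nil _, List.nodup_nil, by simp⟩
  | @head u v huv _ ih =>
    obtain ⟨e, heF, he⟩ := huv
    obtain ⟨l, hl, hnd, hlF⟩ := ih
    by_cases hel : e ∈ l
    · obtain ⟨x, y, l', h1, h2, h3⟩ := hl.exists_suffix hel
      have hnd' : (e :: l').Nodup := hnd.sublist h3.sublist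
      have hF' : ∀ f ∈ e :: l', f ∈ F := fun f hf => hlF f (h3.subset hf)
      rw [he, Sym2.eq_iff] at h1
      rcases h1 with ⟨rfl, rfl⟩ | ⟨rfl, rfl⟩
      · exact ⟨e :: l', .cons he h2, hnd', hF'⟩
      · exact ⟨l', h2, (List.nodup_cons.1 hnd').2, fun f hf => hF' f (List.mem_cons_of_mem _ hf)⟩
    · refine ⟨e :: l, .cons he hl, List.nodup_cons.2 ⟨hel, hnd⟩, fun f hf => ?_⟩
      rcases List.mem_cons.1 hf with rfl | hf
      · exact heF
      · exact hlF f hf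

lemma IsWalk.exists_cut {u w : V} {l : List E} (h : IsWalk ends u w l) {X : Set V} (hu : u ∈ X)
    (hw : w ∉ X) : ∃ e ∈ l, (∃ x ∈ ends e, x ∈ X) ∧ ∃ y ∈ ends e, y ∉ X := by
  induction h with
  | nil => exact absurd hu hw
  | @cons u v w f l hf hl ih =>
    by_cases hv : v ∈ X
    · obtain ⟨e, he, h⟩ := ih hv hw
      exact ⟨e, List.mem_cons_of_mem _ he, h⟩
    · exact ⟨f, by simp, ⟨u, by simp [hf], hu⟩, ⟨v, by simp [hf], hv⟩⟩

lemma EdgeDisjointPathsIn.le_cut [Finite E] {F : Set E} {n : ℕ} {a b : V}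
    (h : EdgeDisjointPathsIn ends F n a b) {X : Set V} (ha : a ∈ X) (hb : b ∉ X) :
    n ≤ (cutEdges ends F X).ncard := by
  obtain ⟨P, hP, hdis⟩ := h
  choose f hf using fun i => (hP i).1.exists_cut ha hb
  have hinj : Function.Injective f := by
    intro i j hij
    by_contra hne
    exact hdis i j hne (f i) (hf i).1 (hij ▸ (hf j).1)
  have : (Set.range f).ncard = n := by
    rw [← Set.image_univ, Set.ncard_image_of_injective _ hinj, Set.ncard_univ, Nat.card_fin]
  rw [← this]
  refine Set.ncard_le_ncard ?_ (Set.toFinite _)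
  rintro _ ⟨i, rfl⟩
  exact ⟨(hP i).2.2 _ (hf i).1, (hf i).2⟩

/-- Menger's theorem. -/
theorem edgeDisjointPathsIn_univ_of_cut [Finite V] [Finite E] {n : ℕ} {a b : V}
    (h : ∀ X : Set V, a ∈ X → b ∉ X → n ≤ (cutEdges ends Set.univ X).ncard) :
    EdgeDisjointPathsIn ends Set.univ n a b := by
  classical
  have := Fintype.ofFinite V
  have := Fintype.ofFinite E
  choose p hp using fun e : E => (Sym2.exists (α := V) (f := fun z => ends e = z)).1 ⟨_, rfl⟩
  choose q hpq using hp
  let tl : E × Bool → V := fun i => if i.2 then p i.1 else q i.1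
  let hd : E × Bool → V := fun i => if i.2 then q i.1 else p i.1
  have hends : ∀ i, ends i.1 = s(tl i, hd i) := by
    rintro ⟨e, _ | _⟩
    · simp [tl, hd, hpq, Sym2.eq_swap]
    · simp [tl, hd, hpq]
  let good : Finset (E × Bool) → Prop := fun U =>
    ∀ X : Finset V, b ∈ X → a ∉ X → n ≤ arcsInto tl hd U X
  have hgood : good Finset.univ := by
    intro X hbX haX
    refine (h (X : Set V)ᶜ (by simpa using haX) (by simpa using hbX)).trans ?_
    have : cutEdges ends Set.univ (X : Set V)ᶜ ⊆
        Prod.fst '' ((Finset.univ.filter fun i => hd i ∈ X ∧ tl i ∉ X : Finset (E × Bool)) :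
          Set (E × Bool)) := by
      rintro e ⟨-, ⟨x, hx, hxX⟩, ⟨y, hy, hyX⟩⟩
      simp only [Set.mem_compl_iff, Finset.mem_coe, not_not] at hxX hyX
      rw [hpq] at hx hy
      simp only [Sym2.mem_iff] at hx hy
      by_cases hpX : p e ∈ X
      · refine ⟨(e, false), ?_, rfl⟩
        simp only [Finset.coe_filter, Finset.mem_univ, true_and, Set.mem_ofPred_eq, hd, tl,
          Bool.false_eq_true, if_false]
        refine ⟨hpX, ?_⟩
        rcases hx with rfl | rfl
        · exact absurd hpX hxX
        · exact hxX
      · refine ⟨(e, true), ?_, rfl⟩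
        simp only [Finset.coe_filter, Finset.mem_univ, true_and, Set.mem_ofPred_eq, hd, tl,
          if_true]
        refine ⟨?_, hpX⟩
        rcases hy with rfl | rfl
        · exact absurd hyX hpX
        · exact hyX
    refine (Set.ncard_le_ncard this (Set.toFinite _)).trans ?_
    refine (Set.ncard_image_le (Set.toFinite _)).trans ?_
    rw [Set.ncard_coe_finset]
    exact le_rfl
  obtain ⟨U, hU, hmin⟩ := Finset.exists_min_image (Finset.univ.filter good) Finset.card
    ⟨Finset.univ, by simpa using hgood⟩
  replace hU : good U := (Finset.mem_filter.1 hU).2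
  have htight : ∀ i ∈ U, ∃ X : Finset V, b ∈ X ∧ a ∉ X ∧ hd i ∈ X ∧ tl i ∉ X ∧
      arcsInto tl hd (U \ {i}) X < n := by
    intro i hi
    have hlt : (U \ {i}).card < U.card := Finset.card_lt_card
      ⟨Finset.sdiff_subset, fun h => (Finset.mem_sdiff.1 (h hi)).2 (by simp)⟩
    have : ¬ good (U \ {i}) := fun hg =>
      absurd (hmin _ (by simpa using hg)) (not_le.2 hlt)
    simp only [good, not_forall, not_le] at this
    obtain ⟨X, hbX, haX, hX⟩ := this
    have h1 := arcsInto_sdiff_singleton tl hd U X i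
    have h2 := hU X hbX haX
    split_ifs at h1 with h3
    · exact ⟨X, hbX, haX, h3.1, h3.2, hX⟩
    · omega
  have hopp : ∀ e, (e, true) ∈ U → (e, false) ∈ U → False := by
    intro e ht hf
    obtain ⟨X, hbX, haX, hX1, hX2, hX⟩ := htight _ ht
    obtain ⟨Y, hbY, haY, hY1, hY2, hY⟩ := htight _ hf
    simp only [hd, tl, if_true, Bool.false_eq_true, if_false] at hX1 hX2 hY1 hY2
    have h1 := arcsInto_submodular tl hd (U \ {(e, true)}) X Y
    have h2 := arcsInto_sdiff_singleton tl hd U Y (e, false)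
    have h3 : arcsInto tl hd (U \ {(e, true)}) Y ≤ arcsInto tl hd U Y :=
      Finset.card_le_card (Finset.filter_subset_filter _ Finset.sdiff_subset)
    have h4 := arcsInto_sdiff_singleton tl hd U (X ∩ Y) (e, true)
    have h5 := arcsInto_sdiff_singleton tl hd U (X ∪ Y) (e, true)
    have h6 := hU (X ∩ Y) (by simp [hbX, hbY]) (by simp [haX])
    have h7 := hU (X ∪ Y) (by simp [hbX]) (by simp [haX, haY])
    rw [if_neg (by simp [hd, tl, hX1, hY2])] at h4
    rw [if_neg (by simp [hd, tl, hX1, hY1])] at h5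
    split_ifs at h2 <;> omega
  let tl' : (E × Bool) ⊕ (V × Fin n) → V := Sum.elim tl fun _ => b
  let hd' : (E × Bool) ⊕ (V × Fin n) → V := Sum.elim hd Prod.fst
  obtain ⟨B, hBD, hdis, hreach, -⟩ := exists_disjoint_arborescences tl' hd' a n
    (U.disjSum Finset.univ) (by
      rintro X ⟨w, hw⟩ haX
      by_cases hbX : b ∈ X
      · refine (hU X hbX haX).trans ?_
        unfold arcsInto
        rw [← Finset.card_map (Function.Embedding.inl (β := V × Fin n))]
        refine Finset.card_le_card fun j hj => ?_
        obtain ⟨i, hi, rfl⟩ := Finset.mem_map.1 hj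
        simpa [hd', tl'] using hi
      · have : (Finset.univ : Finset (Fin n)).card = n := by simp
        unfold arcsInto
        refine this.symm.le.trans ?_
        rw [← Finset.card_map (⟨fun j => Sum.inr (w, j), fun i j hij => by simpa using hij⟩ :
          Fin n ↪ (E × Bool) ⊕ (V × Fin n))]
        refine Finset.card_le_card fun j hj => ?_
        obtain ⟨i, hi, rfl⟩ := Finset.mem_map.1 hj
        exact Finset.mem_filter.2 ⟨Finset.inr_mem_disjSum.2 (Finset.mem_univ _), hw, hbX⟩)
  let Fj : Fin n → Set E := fun j => {e | ∃ c, Sum.inl (e, c) ∈ B j}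
  have hFreach : ∀ j, Reaches ends (Fj j) a b := by
    intro j
    have hr := hreach j b
    clear hreach hmin htight hopp hBD hdis hgood
    generalize a = c at hr
    induction hr using Relation.ReflTransGen.head_induction_on with
    | refl => exact .refl
    | head huv _ ih =>
      obtain ⟨i | i, hi, h1, h2⟩ := huv
      · refine .head ⟨i.1, ⟨i.2, hi⟩, ?_⟩ ih
        rw [hends, ← h1, ← h2]
        rfl
      · have : b = _ := h1
        rw [← this]
        exact .refl
  have hFdis : ∀ i j, i ≠ j → ∀ e ∈ Fj i, e ∉ Fj j := by
    rintro i j hij e ⟨c, hc⟩ ⟨c', hc'⟩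
    have hcU := Finset.inl_mem_disjSum.1 (hBD i hc)
    have hcU' := Finset.inl_mem_disjSum.1 (hBD j hc')
    have : c ≠ c' := by
      rintro rfl
      exact Finset.disjoint_left.1 (hdis i j hij) hc hc'
    cases c <;> cases c' <;> simp at this
    · exact hopp e hcU' hcU
    · exact hopp e hcU hcU'
  choose l hl using fun j => (hFreach j).exists_path
  refine ⟨l, fun i => ⟨(hl i).1, (hl i).2.1, fun _ _ => trivial⟩, fun i j hij e hi hj => ?_⟩
  exact hFdis i j hij e ((hl i).2.2 e hi) ((hl j).2.2 e hj)

end Walks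

section Hypergraphs

variable {α ι : Type} [Fintype ι] [DecidableEq α]

/-- The number of hyperedges contained in no member of `𝒬`. -/
def uncoveredCount (A : ι → Finset α) (𝒬 : Finset (Finset α)) : ℕ :=
  (Finset.univ.filter fun i => ∀ X ∈ 𝒬, ¬ A i ⊆ X).card

lemma uncoveredCount_eq (A : ι → Finset α) (𝒬 : Finset (Finset α))
    [DecidablePred fun i => ∀ X ∈ 𝒬, ¬ A i ⊆ X] :
    uncoveredCount A 𝒬 = (Finset.univ.filter fun i => ∀ X ∈ 𝒬, ¬ A i ⊆ X).card := by
  unfold uncoveredCount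
  congr

/-- Frank's theorem on orienting a hypergraph so as to cover an intersecting supermodular
set function. -/
theorem exists_orientation_covering [Fintype α] (A : ι → Finset α) (hA : ∀ i, (A i).Nonempty)
    (p : Finset α → ℕ)
    (hp : ∀ X Y, (X ∩ Y).Nonempty → p X + p Y ≤ p (X ∩ Y) + p (X ∪ Y))
    (hpu : p Finset.univ = 0)
    (hpart : ∀ 𝒬 : Finset (Finset α), (∀ X ∈ 𝒬, X.Nonempty) →
      (∀ X ∈ 𝒬, ∀ Y ∈ 𝒬, X ≠ Y → Disjoint X Y) → (∀ u, ∃ X ∈ 𝒬, u ∈ X) →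
      ∑ X ∈ 𝒬, p X ≤ uncoveredCount A 𝒬) :
    ∃ h : ι → α, (∀ i, h i ∈ A i) ∧ ∀ X : Finset α, X.Nonempty →
      p X ≤ (Finset.univ.filter fun i => h i ∈ X ∧ ¬ A i ⊆ X).card := by
  classical
  rcases isEmpty_or_nonempty α with hα | hα
  · exact ⟨fun i => (hA i).choose, fun i => (hA i).choose_spec,
      fun X hX => isEmptyElim hX.choose⟩
  let ind : Finset α → ℕ := fun X => (Finset.univ.filter fun i => A i ⊆ X).card
  have hind : ∀ X Y, ind X + ind Y ≤ ind (X ∩ Y) + ind (X ∪ Y) := by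
    intro X Y
    simp only [ind, Finset.card_filter, ← Finset.sum_add_distrib]
    refine Finset.sum_le_sum fun i _ => ?_
    simp only [Finset.subset_inter_iff]
    have h1 : A i ⊆ X → A i ⊆ X ∪ Y := fun h => h.trans Finset.subset_union_left
    have h2 : A i ⊆ Y → A i ⊆ X ∪ Y := fun h => h.trans Finset.subset_union_right
    by_cases h3 : A i ⊆ X <;> by_cases h4 : A i ⊆ Y <;> simp [h3, h4, h1, h2]
  let good : (α → ℕ) → Prop := fun m => ∀ X : Finset α, X.Nonempty → p X + ind X ≤ ∑ u ∈ X, m u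
  have hex : ∃ n m, good m ∧ ∑ u, m u = n := by
    refine ⟨_, fun _ => ∑ X, p X + Fintype.card ι, ?_, rfl⟩
    intro X hX
    have h1 : p X ≤ ∑ X, p X := Finset.single_le_sum (fun _ _ => Nat.zero_le _) (Finset.mem_univ X)
    have h2 : ind X ≤ Fintype.card ι := Finset.card_filter_le _ _
    have h3 := Finset.card_pos.2 hX
    rw [Finset.sum_const, smul_eq_mul]
    nlinarith
  obtain ⟨m, hm, hmn⟩ := Nat.find_spec hex
  have hmin : ∀ m', good m' → ∑ u, m u ≤ ∑ u, m' u := fun m' hm' => by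
    rw [hmn]
    exact Nat.find_min' hex ⟨m', hm', rfl⟩
  let tight : Finset α → Prop := fun X => X.Nonempty ∧ ∑ u ∈ X, m u = p X + ind X
  have htight : ∀ u, ∃ X, tight X ∧ u ∈ X := by
    intro u
    by_cases hu : m u = 0
    · refine ⟨{u}, ⟨by simp, ?_⟩, by simp⟩
      have := hm {u} (by simp)
      simp only [Finset.sum_singleton] at this ⊢
      omega
    · let m' := Function.update m u (m u - 1)
      have hsum : ∀ X : Finset α, u ∈ X → ∑ w ∈ X, m w = ∑ w ∈ X, m' w + 1 := by
        intro X huX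
        have h1 := Finset.add_sum_erase X m huX
        have h2 := Finset.add_sum_erase X m' huX
        have h3 : ∑ w ∈ X.erase u, m' w = ∑ w ∈ X.erase u, m w :=
          Finset.sum_congr rfl fun w hw => by simp [m', (Finset.mem_erase.1 hw).1]
        have h4 : m' u = m u - 1 := by simp [m']
        omega
      have hng : ¬ good m' := fun hg => by
        have := hmin m' hg
        have := hsum Finset.univ (Finset.mem_univ u)
        omega
      simp only [good, not_forall, not_le] at hng
      obtain ⟨X, hX, hlt⟩ := hng
      have h1 := hm X hX
      by_cases huX : u ∈ X
      · have := hsum X huX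
        exact ⟨X, ⟨hX, by omega⟩, huX⟩
      · have : ∑ w ∈ X, m' w = ∑ w ∈ X, m w :=
          Finset.sum_congr rfl fun w hw => by
            have : w ≠ u := fun h => huX (h ▸ hw)
            simp [m', this]
        omega
  have hunion : ∀ X Y, tight X → tight Y → (X ∩ Y).Nonempty → tight (X ∪ Y) := by
    intro X Y hX hY hXY
    refine ⟨hX.1.mono Finset.subset_union_left, ?_⟩
    have h1 := hm _ hXY
    have h2 := hm _ (hX.1.mono (Finset.subset_union_left (s₂ := Y)))
    have h3 := hp X Y hXY
    have h4 := hind X Y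
    have h5 := Finset.sum_union_inter (s₁ := X) (s₂ := Y) (f := m)
    have h6 := hX.2
    have h7 := hY.2
    omega
  have hmaxex : ∀ u, ∃ X, (tight X ∧ u ∈ X) ∧ ∀ Y, tight Y → u ∈ Y → Y.card ≤ X.card := by
    intro u
    obtain ⟨X, hX⟩ := htight u
    obtain ⟨Y, hY, hmax⟩ := Finset.exists_max_image
      (Finset.univ.filter fun X => tight X ∧ u ∈ X) Finset.card ⟨X, by simpa using hX⟩
    exact ⟨Y, (Finset.mem_filter.1 hY).2, fun Z h1 h2 => hmax Z (by simp [h1, h2])⟩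
  choose T hT hTmax using hmaxex
  have hsub : ∀ u w, (T u ∩ T w).Nonempty → T w ⊆ T u := by
    intro u w huw
    have h1 := hunion _ _ (hT u).1 (hT w).1 huw
    have h2 := hTmax u _ h1 (Finset.mem_union_left _ (hT u).2)
    rw [Finset.eq_of_subset_of_card_le Finset.subset_union_left h2]
    exact Finset.subset_union_right
  let 𝒬 : Finset (Finset α) := Finset.univ.image T
  have hdis : ∀ X ∈ 𝒬, ∀ Y ∈ 𝒬, X ≠ Y → Disjoint X Y := by
    intro X hX Y hY hXY
    obtain ⟨u, -, rfl⟩ := Finset.mem_image.1 hX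
    obtain ⟨w, -, rfl⟩ := Finset.mem_image.1 hY
    by_contra hd
    rw [Finset.not_disjoint_iff_nonempty_inter] at hd
    exact hXY ((hsub w u (by rwa [Finset.inter_comm])).antisymm (hsub u w hd))
  have hne : ∀ X ∈ 𝒬, X.Nonempty := by
    intro X hX
    obtain ⟨u, -, rfl⟩ := Finset.mem_image.1 hX
    exact ⟨u, (hT u).2⟩
  have hQtight : ∀ X ∈ 𝒬, ∑ u ∈ X, m u = p X + ind X := by
    intro X hX
    obtain ⟨u, -, rfl⟩ := Finset.mem_image.1 hX
    exact (hT u).1.2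
  have hcov : ∀ u, ∃ X ∈ 𝒬, u ∈ X := fun u =>
    ⟨T u, Finset.mem_image_of_mem _ (Finset.mem_univ u), (hT u).2⟩
  have hQ := hpart 𝒬 hne hdis hcov
  have hsumQ : ∑ X ∈ 𝒬, ∑ u ∈ X, m u = ∑ u, m u := by
    have := Finset.sum_biUnion (s := 𝒬) (t := id) (f := m)
      (fun X hX Y hY hXY => hdis X hX Y hY hXY)
    simp only [id] at this
    rw [← this]
    congr 1
    ext u
    simpa using hcov u
  have hindQ : ∑ X ∈ 𝒬, ind X + uncoveredCount A 𝒬 = Fintype.card ι := by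
    rw [uncoveredCount_eq]
    have h1 := Finset.card_biUnion (s := 𝒬)
      (t := fun X => Finset.univ.filter fun i => A i ⊆ X) (by
        intro X hX Y hY hXY
        refine Finset.disjoint_left.2 fun i hi hj => ?_
        obtain ⟨u, hu⟩ := hA i
        exact Finset.disjoint_left.1 (hdis X hX Y hY hXY) ((Finset.mem_filter.1 hi).2 hu)
          ((Finset.mem_filter.1 hj).2 hu))
    rw [← h1, ← Finset.card_union_of_disjoint, ← Finset.card_univ]
    · congr 1
      ext i
      simp only [Finset.mem_union, Finset.mem_biUnion, Finset.mem_filter, Finset.mem_univ,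
        true_and, iff_true]
      by_cases h : ∃ X ∈ 𝒬, A i ⊆ X
      · exact Or.inl h
      · push Not at h
        exact Or.inr h
    · refine Finset.disjoint_left.2 fun i hi hj => ?_
      obtain ⟨X, hX, hiX⟩ := Finset.mem_biUnion.1 hi
      exact (Finset.mem_filter.1 hj).2 X hX (Finset.mem_filter.1 hiX).2
  have htot : ∑ u, m u ≤ Fintype.card ι := by
    rw [← hsumQ, Finset.sum_congr rfl hQtight, Finset.sum_add_distrib]
    omega
  obtain ⟨f, hf, hft⟩ := (Finset.all_card_le_biUnion_card_iff_exists_injective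
    (fun i => (A i).sigma fun u => Finset.range (m u))).1 (by
      intro s
      rcases s.eq_empty_or_nonempty with rfl | ⟨i, hi⟩
      · simp
      have h1 := hm (s.biUnion A) (by
        obtain ⟨u, hu⟩ := hA i
        exact ⟨u, Finset.mem_biUnion.2 ⟨i, hi, hu⟩⟩)
      have h2 : s.card ≤ ind (s.biUnion A) := Finset.card_le_card fun j hj => by
        simpa using Finset.subset_biUnion_of_mem A hj
      have h3 : ((s.biUnion A).sigma fun u => Finset.range (m u)) ⊆
          s.biUnion fun i => (A i).sigma fun u => Finset.range (m u) := by
        rintro ⟨u, j⟩ hu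
        simp only [Finset.mem_sigma, Finset.mem_biUnion] at hu ⊢
        obtain ⟨⟨i, hi, hui⟩, hj⟩ := hu
        exact ⟨i, hi, hui, hj⟩
      have h4 := Finset.card_le_card h3
      rw [Finset.card_sigma] at h4
      simp only [Finset.card_range] at h4
      omega)
  have hle : ∀ X : Finset α, (Finset.univ.filter fun i => (f i).1 ∈ X).card ≤ ∑ u ∈ X, m u := by
    intro X
    have h1 : ((Finset.univ.filter fun i => (f i).1 ∈ X).image f) ⊆
        X.sigma fun u => Finset.range (m u) := by
      intro x hx
      obtain ⟨i, hi, rfl⟩ := Finset.mem_image.1 hx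
      exact Finset.mem_sigma.2 ⟨(Finset.mem_filter.1 hi).2, (Finset.mem_sigma.1 (hft i)).2⟩
    have h2 := Finset.card_le_card h1
    rw [Finset.card_image_of_injective _ hf, Finset.card_sigma] at h2
    simpa using h2
  refine ⟨fun i => (f i).1, fun i => (Finset.mem_sigma.1 (hft i)).1, fun X hX => ?_⟩
  have h1 := hle Xᶜ
  have h2 := Finset.sum_add_sum_compl X m
  have h3 := hm Finset.univ Finset.univ_nonempty
  have h4 : ind Finset.univ = Fintype.card ι := by simp [ind]
  have h5 := Finset.card_filter_add_card_filter_not (s := (Finset.univ : Finset ι))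
    (fun i => (f i).1 ∈ X)
  have h6 : (Finset.univ.filter fun i => (f i).1 ∈ X).card ≤
      (Finset.univ.filter fun i => (f i).1 ∈ X ∧ ¬ A i ⊆ X).card + ind X := by
    refine (Finset.card_le_card ?_).trans (Finset.card_union_le _ _)
    intro i hi
    by_cases hiX : A i ⊆ X
    · simp [hiX]
    · simpa [hiX] using hi
  have h7 := hm X hX
  simp only [Finset.mem_compl] at h1
  rw [Finset.card_univ] at h5
  change p X ≤ (Finset.univ.filter fun i => (f i).1 ∈ X ∧ ¬ A i ⊆ X).card
  omega

/-- Trimming the hyperedges of an oriented hypergraph to size at most two. -/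
lemma exists_trimming [Fintype α] (A : ι → Finset α) (h : ι → α) (hh : ∀ i, h i ∈ A i) (r : α)
    (m : ℕ) (hcut : ∀ X : Finset α, X.Nonempty → r ∉ X →
      m ≤ (Finset.univ.filter fun i => h i ∈ X ∧ ¬ A i ⊆ X).card) :
    ∃ B : ι → Finset α, (∀ i, B i ⊆ A i) ∧ (∀ i, h i ∈ B i) ∧ (∀ i, (B i).card ≤ 2) ∧
      (∀ i, 2 ≤ (A i).card → 2 ≤ (B i).card) ∧ ∀ X : Finset α, X.Nonempty → r ∉ X →
      m ≤ (Finset.univ.filter fun i => h i ∈ X ∧ ¬ B i ⊆ X).card := by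
  classical
  let good : (ι → Finset α) → Prop := fun B => (∀ i, B i ⊆ A i) ∧ (∀ i, h i ∈ B i) ∧
    (∀ i, 2 ≤ (A i).card → 2 ≤ (B i).card) ∧ ∀ X : Finset α, X.Nonempty → r ∉ X →
      m ≤ (Finset.univ.filter fun i => h i ∈ X ∧ ¬ B i ⊆ X).card
  have hgood : good A := ⟨fun _ => subset_rfl, hh, fun _ h => h, hcut⟩
  obtain ⟨B, hB, hmin⟩ := Finset.exists_min_image (Finset.univ.filter good)
    (fun B => ∑ i, (B i).card) ⟨A, by simpa using hgood⟩
  obtain ⟨hBA, hhB, hB2, hBcut⟩ := (Finset.mem_filter.1 hB).2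
  refine ⟨B, hBA, hhB, fun i => ?_, hB2, hBcut⟩
  by_contra! hi
  have htight : ∀ b ∈ B i, b ≠ h i → ∃ X : Finset α, r ∉ X ∧ h i ∈ X ∧ b ∉ X ∧
      (∀ c ∈ B i, c ≠ b → c ∈ X) ∧
      (Finset.univ.filter fun j => h j ∈ X ∧ ¬ B j ⊆ X).card ≤ m := by
    intro b hb hbh
    let B' := Function.update B i ((B i).erase b)
    have hlt : ∑ j, (B' j).card < ∑ j, (B j).card := by
      refine Finset.sum_lt_sum (fun j _ => ?_) ⟨i, Finset.mem_univ i, ?_⟩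
      · by_cases hj : j = i
        · subst hj
          simpa [B'] using Finset.card_erase_le
        · simp [B', hj]
      · simpa [B'] using Finset.card_erase_lt_of_mem hb
    have hng : ¬ good B' := fun hg => absurd (hmin B' (by simpa using hg)) (not_le.2 hlt)
    have hcut' : ∃ X : Finset α, X.Nonempty ∧ r ∉ X ∧
        (Finset.univ.filter fun j => h j ∈ X ∧ ¬ B' j ⊆ X).card < m := by
      by_contra! hcon
      refine hng ⟨fun j => ?_, fun j => ?_, fun j hj => ?_, hcon⟩
      · by_cases hj : j = i
        · subst hj
          simpa [B'] using (Finset.erase_subset _ _).trans (hBA j)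
        · simpa [B', hj] using hBA j
      · by_cases hj : j = i
        · subst hj
          simpa [B', hhB] using hbh.symm
        · simpa [B', hj] using hhB j
      · by_cases hji : j = i
        · subst hji
          simp only [B', Function.update_self, Finset.card_erase_of_mem hb]
          omega
        · simpa [B', hji] using hB2 j hj
    obtain ⟨X, hX, hrX, hXm⟩ := hcut'
    have h1 := hBcut X hX hrX
    have h2 : (Finset.univ.filter fun j => h j ∈ X ∧ ¬ B j ⊆ X) ⊆
        insert i (Finset.univ.filter fun j => h j ∈ X ∧ ¬ B' j ⊆ X) := by
      intro j hj
      by_cases hji : j = i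
      · simp [hji]
      · simpa [hji, B'] using hj
    have h3 := (Finset.card_le_card h2).trans (Finset.card_insert_le _ _)
    have h4 : (h i ∈ X ∧ ¬ B i ⊆ X) ∧ B' i ⊆ X := by
      by_contra hcon
      have : (Finset.univ.filter fun j => h j ∈ X ∧ ¬ B j ⊆ X) ⊆
          (Finset.univ.filter fun j => h j ∈ X ∧ ¬ B' j ⊆ X) := by
        intro j hj
        by_cases hji : j = i
        · subst hji
          simp only [Finset.mem_filter, Finset.mem_univ, true_and] at hj ⊢
          tauto
        · simpa [hji, B'] using hj
      have := Finset.card_le_card this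
      omega
    simp only [B', Function.update_self] at h4
    have h5 : ∀ c ∈ B i, c ≠ b → c ∈ X := fun c hc hcb => h4.2 (Finset.mem_erase.2 ⟨hcb, hc⟩)
    refine ⟨X, hrX, h4.1.1, fun hbX => h4.1.2 fun c hc => ?_, h5, by omega⟩
    by_cases hcb : c = b
    · rwa [hcb]
    · exact h5 c hc hcb
  have hcard : 1 < ((B i).erase (h i)).card := by
    rw [Finset.card_erase_of_mem (hhB i)]
    omega
  obtain ⟨b, hb, c, hc, hbc⟩ := Finset.one_lt_card.1 hcard
  rw [Finset.mem_erase] at hb hc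
  obtain ⟨X, hrX, hhX, hbX, hX, hXm⟩ := htight b hb.2 hb.1
  obtain ⟨Y, hrY, hhY, hcY, hY, hYm⟩ := htight c hc.2 hc.1
  have hcX := hX c hc.2 hbc.symm
  have hbY := hY b hb.2 hbc
  have h1 := hBcut (X ∩ Y) ⟨h i, by simp [hhX, hhY]⟩ (by simp [hrX])
  have h2 := hBcut (X ∪ Y) ⟨h i, by simp [hhX]⟩ (by simp [hrX, hrY])
  have hiU : B i ⊆ X ∪ Y := by
    intro d hd
    by_cases hdb : d = b
    · simp [hdb, hbY]
    · simp [hX d hd hdb]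
  have h3 : (Finset.univ.filter fun j => h j ∈ X ∩ Y ∧ ¬ B j ⊆ X ∩ Y).card +
      (Finset.univ.filter fun j => h j ∈ X ∪ Y ∧ ¬ B j ⊆ X ∪ Y).card <
      (Finset.univ.filter fun j => h j ∈ X ∧ ¬ B j ⊆ X).card +
      (Finset.univ.filter fun j => h j ∈ Y ∧ ¬ B j ⊆ Y).card := by
    simp only [Finset.card_filter, ← Finset.sum_add_distrib]
    refine Finset.sum_lt_sum (fun j _ => ?_) ⟨i, Finset.mem_univ i, ?_⟩
    · have e2 : B j ⊆ X → B j ⊆ X ∪ Y := fun h => h.trans Finset.subset_union_left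
      have e3 : B j ⊆ Y → B j ⊆ X ∪ Y := fun h => h.trans Finset.subset_union_right
      have e5 : B j ⊆ X → h j ∈ X := fun h => h (hhB j)
      have e6 : B j ⊆ Y → h j ∈ Y := fun h => h (hhB j)
      simp only [Finset.subset_inter_iff, Finset.mem_inter, Finset.mem_union]
      clear * - e2 e3 e5 e6
      grind
    · have e1 : ¬ B i ⊆ X := fun h => hbX (h hb.2)
      have e2 : ¬ B i ⊆ Y := fun h => hcY (h hc.2)
      simp [hhX, hhY, e1, e2, hiU, Finset.subset_inter_iff]
  omega

end Hypergraphs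

section HypergraphPacking

variable {α ι : Type} [Fintype ι] [DecidableEq α]

/-- The number of hyperedges meeting both `X` and its complement. -/
def hyperCut (A : ι → Finset α) (X : Finset α) : ℕ :=
  (Finset.univ.filter fun i => (∃ u ∈ A i, u ∈ X) ∧ ¬ A i ⊆ X).card

lemma sum_hyperCut_le (A : ι → Finset α) (c : ℕ) (hc : ∀ i, (A i).card ≤ c)
    (𝒬 : Finset (Finset α)) (hdis : ∀ X ∈ 𝒬, ∀ Y ∈ 𝒬, X ≠ Y → Disjoint X Y) :
    ∑ X ∈ 𝒬, hyperCut A X ≤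
      c * uncoveredCount A 𝒬 := by
  classical
  have h1 : ∑ X ∈ 𝒬, hyperCut A X =
      ∑ i, (𝒬.filter fun X => (∃ u ∈ A i, u ∈ X) ∧ ¬ A i ⊆ X).card := by
    simp only [hyperCut, Finset.card_filter]
    exact Finset.sum_comm
  rw [h1, uncoveredCount_eq, Finset.card_filter, Finset.mul_sum]
  refine Finset.sum_le_sum fun i _ => ?_
  split_ifs with hi
  · rw [mul_one]
    refine le_trans ?_ (hc i)
    refine Finset.card_le_card_of_forall_subsingleton (fun X u => u ∈ X)
      (fun X hX => (Finset.mem_filter.1 hX).2.1) ?_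
    rintro u - X ⟨hX, huX⟩ Y ⟨hY, huY⟩
    by_contra hne
    exact Finset.disjoint_left.1 (hdis X (Finset.mem_filter.1 hX).1 Y (Finset.mem_filter.1 hY).1
      hne) huX huY
  · push Not at hi
    obtain ⟨X, hX, hiX⟩ := hi
    rw [mul_zero, Nat.le_zero, Finset.card_eq_zero, Finset.filter_eq_empty_iff]
    rintro Y hY ⟨⟨u, hu, huY⟩, hiY⟩
    by_cases hXY : X = Y
    · exact hiY (hXY ▸ hiX)
    · exact Finset.disjoint_left.1 (hdis X hX Y hY hXY) (hiX hu) huY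

lemma sum_entering_le (A : ι → Finset α) (h : ι → α) (hh : ∀ i, h i ∈ A i)
    (𝒬 : Finset (Finset α)) (hdis : ∀ X ∈ 𝒬, ∀ Y ∈ 𝒬, X ≠ Y → Disjoint X Y)
    (𝒬' : Finset (Finset α)) (h𝒬' : 𝒬' ⊆ 𝒬) :
    ∑ X ∈ 𝒬', (Finset.univ.filter fun i => h i ∈ X ∧ ¬ A i ⊆ X).card ≤
      uncoveredCount A 𝒬 := by
  classical
  rw [uncoveredCount_eq]
  rw [← Finset.card_biUnion]
  · refine Finset.card_le_card fun i hi => ?_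
    obtain ⟨X, hX, hi⟩ := Finset.mem_biUnion.1 hi
    replace hi := (Finset.mem_filter.1 hi).2
    refine Finset.mem_filter.2 ⟨Finset.mem_univ _, fun Y hY hiY => ?_⟩
    by_cases hXY : X = Y
    · exact hi.2 (hXY ▸ hiY)
    · exact Finset.disjoint_left.1 (hdis X (h𝒬' hX) Y hY hXY) hi.1 (hiY (hh i))
  · intro X hX Y hY hXY
    refine Finset.disjoint_left.2 fun i hi hj => ?_
    exact Finset.disjoint_left.1 (hdis X (h𝒬' hX) Y (h𝒬' hY) hXY) (Finset.mem_filter.1 hi).2.1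
      (Finset.mem_filter.1 hj).2.1

variable [Fintype α]

lemma partition_trivial_or_proper (𝒬 : Finset (Finset α)) (hne : ∀ X ∈ 𝒬, X.Nonempty)
    (hdis : ∀ X ∈ 𝒬, ∀ Y ∈ 𝒬, X ≠ Y → Disjoint X Y) (hcov : ∀ u, ∃ X ∈ 𝒬, u ∈ X) :
    (∀ X ∈ 𝒬, X = Finset.univ) ∨ (2 ≤ 𝒬.card ∧ ∀ X ∈ 𝒬, X ≠ Finset.univ) := by
  by_cases h : ∀ X ∈ 𝒬, X ≠ Finset.univ
  · by_cases h2 : 2 ≤ 𝒬.card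
    · exact .inr ⟨h2, h⟩
    · left
      intro X hX
      refine Finset.eq_univ_of_forall fun u => ?_
      obtain ⟨Y, hY, huY⟩ := hcov u
      rwa [Finset.card_le_one.1 (by omega : 𝒬.card ≤ 1) X hX Y hY]
  · push Not at h
    obtain ⟨X, hX, hXu⟩ := h
    left
    intro Y hY
    by_contra hYu
    obtain ⟨u, hu⟩ := hne Y hY
    exact Finset.disjoint_left.1 (hdis X hX Y hY (fun h => hYu (h ▸ hXu)))
      (hXu ▸ Finset.mem_univ u) hu

lemma exists_rooted_trimming (A : ι → Finset α) (hA : ∀ i, (A i).Nonempty)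
    (hA3 : ∀ i, (A i).card ≤ 3) (r : α) (m : ℕ)
    (hcut : ∀ X : Finset α, X.Nonempty → X ≠ Finset.univ → 3 * m ≤ hyperCut A X) :
    ∃ (B : ι → Finset α) (h : ι → α), (∀ i, B i ⊆ A i) ∧ (∀ i, h i ∈ B i) ∧
      (∀ i, (B i).card ≤ 2) ∧ (∀ i, 2 ≤ (A i).card → 2 ≤ (B i).card) ∧
      ∀ X : Finset α, X.Nonempty → r ∉ X →
        m ≤ (Finset.univ.filter fun i => h i ∈ X ∧ ¬ B i ⊆ X).card := by
  classical
  obtain ⟨h, hh, hhX⟩ := exists_orientation_covering A hA (fun X => if r ∈ X then 0 else m) (by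
      intro X Y hXY
      by_cases h1 : r ∈ X <;> by_cases h2 : r ∈ Y <;> simp [h1, h2]) (by simp) (by
      intro 𝒬 hne hdis hcov
      rcases partition_trivial_or_proper 𝒬 hne hdis hcov with h | ⟨-, h⟩
      · rw [Finset.sum_eq_zero fun X hX => by simp [h X hX]]
        exact Nat.zero_le _
      · have h1 := sum_hyperCut_le A 3 hA3 𝒬 hdis
        have h2 : ∑ X ∈ 𝒬, 3 * (if r ∈ X then 0 else m) ≤ ∑ X ∈ 𝒬, hyperCut A X := by
          refine Finset.sum_le_sum fun X hX => ?_
          have := hcut X (hne X hX) (h X hX)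
          split_ifs <;> omega
        rw [← Finset.mul_sum] at h2
        omega)
  obtain ⟨B, h1, h2, h3, h4, h5⟩ := exists_trimming A h hh r m (fun X hX hr => by
    simpa [hr] using hhX X hX)
  exact ⟨B, h, h1, h2, h3, h4, h5⟩

lemma packing_arith {k s q σ e m : ℕ} (hm : 7 * k ≤ 4 * m) (h1 : m * (s + q) ≤ e + m)
    (h2 : 10 * σ + 4 * (m * q) ≤ 8 * e) (h3 : k * s ≤ σ) (h4 : σ ≤ 2 * (k * s))
    (h5 : 2 ≤ s + q) :
    (1 ≤ s → σ + k * q ≤ e) ∧ (1 ≤ q → σ + k * q ≤ e + k) := by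
  obtain ⟨t, ht⟩ : ∃ t, s + q = t + 1 := ⟨s + q - 1, by omega⟩
  have h6 : m * t ≤ e := by
    rw [ht, mul_add] at h1
    omega
  have h7 : 7 * (k * t) ≤ 4 * e := by nlinarith
  have h8 : 7 * (k * q) ≤ 4 * (m * q) := by nlinarith
  have h9 : k * s + k * q = k * t + k := by rw [← mul_add, ht]; ring
  constructor
  · intro hs
    by_cases hq : q ≤ 2 * s
    · have : k * q ≤ 2 * (k * s) := by nlinarith
      omega
    · have : 2 * (k * s) + k ≤ k * q := by nlinarith
      have : k ≤ k * s := by nlinarith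
      omega
  · intro hq
    by_cases hs : s + 3 ≤ 3 * q
    · have : k * s + 3 * k ≤ 3 * (k * q) := by nlinarith
      omega
    · have : 3 * (k * q) ≤ k * s + 2 * k := by nlinarith
      omega

lemma exists_balanced_orientation (hα : 2 ≤ Fintype.card α) (A : ι → Finset α)
    (hA : ∀ i, (A i).Nonempty) (hA3 : ∀ i, (A i).card ≤ 3) (k : ℕ) (hk : 8 ≤ k)
    (hcut : ∀ X : Finset α, X.Nonempty → X ≠ Finset.univ → 11 * k / 2 ≤ hyperCut A X) (r : α) :
    ∃ (B : ι → Finset α) (h : ι → α), (∀ i, B i ⊆ A i) ∧ (∀ i, h i ∈ B i) ∧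
      (∀ i, (B i).card ≤ 2) ∧
      (∀ X : Finset α, X.Nonempty → r ∉ X →
        k ≤ (Finset.univ.filter fun i => h i ∈ X ∧ ¬ B i ⊆ X).card) ∧
      ∀ u, 2 * k ≤ (Finset.univ.filter fun i => h i ∈ ({u} : Finset α) ∧ ¬ B i ⊆ {u}).card +
        (Finset.univ.filter fun i => u ∈ A i \ B i).card ∨
        k ≤ (Finset.univ.filter fun i => u ∈ A i \ B i).card := by
  classical
  obtain ⟨m, hm3, hm⟩ : ∃ m, 3 * m ≤ 11 * k / 2 ∧ 7 * k ≤ 4 * m :=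
    ⟨11 * k / 2 / 3, by omega, by omega⟩
  obtain ⟨B, h, hBA, hhB, hB2, hAB, hBcut⟩ := exists_rooted_trimming A hA hA3 r m
    fun X h1 h2 => hm3.trans (hcut X h1 h2)
  let res : α → ℕ := fun u => (Finset.univ.filter fun i => u ∈ A i \ B i).card
  have hcutB : ∀ X : Finset α, X.Nonempty → X ≠ Finset.univ → m ≤ hyperCut B X := by
    intro X hX hXu
    by_cases hr : r ∈ X
    · have hne : Xᶜ.Nonempty := by rwa [Finset.nonempty_iff_ne_empty, Ne, Finset.compl_eq_empty_iff]
      refine (hBcut Xᶜ hne (by simpa using hr)).trans (Finset.card_le_card fun i hi => ?_)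
      simp only [Finset.mem_filter, Finset.mem_univ, true_and, Finset.mem_compl,
        Finset.not_subset, not_not] at hi ⊢
      exact ⟨hi.2, h i, hhB i, hi.1⟩
    · refine (hBcut X hX hr).trans (Finset.card_le_card fun i hi => ?_)
      simp only [Finset.mem_filter, Finset.mem_univ, true_and] at hi ⊢
      exact ⟨⟨h i, hhB i, hi.1⟩, hi.2⟩
  have hcutu : ∀ u, 11 * k / 2 ≤ hyperCut B {u} + res u := by
    intro u
    have hu : ({u} : Finset α) ≠ Finset.univ := fun h => by
      rw [← Finset.card_univ, ← h, Finset.card_singleton] at hα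
      omega
    refine (hcut {u} (by simp) hu).trans ((Finset.card_le_card ?_).trans (Finset.card_union_le _ _))
    intro i hi
    simp only [Finset.mem_filter, Finset.mem_univ, true_and, Finset.mem_union, Finset.mem_singleton,
      Finset.mem_sdiff, exists_eq_right] at hi ⊢
    by_cases huB : u ∈ B i
    · left
      refine ⟨huB, fun hsub => hi.2 ?_⟩
      have h1 := Finset.card_le_card hsub
      rw [Finset.card_singleton] at h1
      have h2 : (A i).card ≤ 1 := by
        by_contra hc
        have := hAB i (by omega)
        omega
      intro w hw
      rw [Finset.mem_singleton]
      exact Finset.card_le_one.1 h2 w hw u hi.1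
    · exact .inr ⟨hi.1, huB⟩
  let small : Finset α → Prop := fun X => X.card = 1 ∧ ∑ u ∈ X, res u < k
  let p : Finset α → ℕ := fun X =>
    if small X then 2 * k - ∑ u ∈ X, res u else if r ∈ X then 0 else k
  have hpbase : ∀ X, (if r ∈ X then 0 else k) ≤ p X := by
    intro X
    simp only [p]
    by_cases hs : small X
    · rw [if_pos hs]
      have := hs.2
      split_ifs <;> omega
    · rw [if_neg hs]
  obtain ⟨h', hh', hp'⟩ := exists_orientation_covering B (fun i => ⟨h i, hhB i⟩) p (by
      intro X Y hXY
      have hsing : ∀ Z : Finset α, Z.card = 1 → ∀ Z', (Z ∩ Z').Nonempty → Z ⊆ Z' := by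
        intro Z hZ Z' hZZ'
        obtain ⟨u, rfl⟩ := Finset.card_eq_one.1 hZ
        obtain ⟨w, hw⟩ := hZZ'
        simp only [Finset.mem_inter, Finset.mem_singleton] at hw
        simpa [← hw.1] using hw.2
      by_cases hX : X.card = 1
      · have := hsing X hX Y hXY
        rw [Finset.inter_eq_left.2 this, Finset.union_eq_right.2 this]
      by_cases hY : Y.card = 1
      · have := hsing Y hY X (by rwa [Finset.inter_comm])
        rw [Finset.inter_eq_right.2 this, Finset.union_eq_left.2 this, add_comm]
      have h1 := hpbase (X ∩ Y)
      have h2 := hpbase (X ∪ Y)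
      have h3 : p X = if r ∈ X then 0 else k := if_neg fun h => hX h.1
      have h4 : p Y = if r ∈ Y then 0 else k := if_neg fun h => hY h.1
      simp only [Finset.mem_inter, Finset.mem_union] at h1 h2
      by_cases h5 : r ∈ X <;> by_cases h6 : r ∈ Y <;> simp only [h5, h6] at h1 h2 h3 h4 <;>
        simp at h1 h2 h3 h4 <;> omega) (by
      have : ¬ small Finset.univ := fun h => by
        have := h.1
        rw [Finset.card_univ] at this
        omega
      simp [p, this]) (by
      intro 𝒬 hne hdis hcov
      set e := uncoveredCount B 𝒬 with he
      rcases partition_trivial_or_proper 𝒬 hne hdis hcov with hQ | ⟨hQ2, hQ⟩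
      · rw [Finset.sum_eq_zero]
        · exact Nat.zero_le _
        · intro X hX
          have : ¬ small X := fun h => by
            have := h.1
            rw [hQ X hX, Finset.card_univ] at this
            omega
          rw [hQ X hX] at this ⊢
          simp [p, this]
      let 𝒮 := 𝒬.filter small
      let 𝒯 := 𝒬.filter fun X => ¬ small X
      have hsmall : ∀ X ∈ 𝒮, k ≤ p X ∧ p X ≤ 2 * k ∧ 10 * p X ≤ 4 * hyperCut B X := by
        intro X hX
        have hs := (Finset.mem_filter.1 hX).2
        have h1 : p X = 2 * k - ∑ u ∈ X, res u := if_pos hs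
        have h2 := hs.2
        obtain ⟨u, rfl⟩ := Finset.card_eq_one.1 hs.1
        have h3 := hcutu u
        rw [Finset.sum_singleton] at h1 h2
        refine ⟨by omega, by omega, by omega⟩
      have hcard : 𝒮.card + 𝒯.card = 𝒬.card := Finset.card_filter_add_card_filter_not _
      have hsum : ∑ X ∈ 𝒮, p X + ∑ X ∈ 𝒯, p X = ∑ X ∈ 𝒬, p X :=
        Finset.sum_filter_add_sum_filter_not _ _ _
      have hsumc : ∑ X ∈ 𝒮, hyperCut B X + ∑ X ∈ 𝒯, hyperCut B X = ∑ X ∈ 𝒬, hyperCut B X :=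
        Finset.sum_filter_add_sum_filter_not _ _ _
      have h1 : m * (𝒮.card + 𝒯.card) ≤ e + m := by
        have h2 := sum_entering_le B h hhB 𝒬 hdis (𝒬.filter fun X => r ∉ X)
          (Finset.filter_subset _ _)
        have h3 := Finset.card_nsmul_le_sum (𝒬.filter fun X => r ∉ X)
          (fun X => (Finset.univ.filter fun i => h i ∈ X ∧ ¬ B i ⊆ X).card) m
          (fun X hX => hBcut X (hne X (Finset.mem_filter.1 hX).1) (Finset.mem_filter.1 hX).2)
        have h4 : (𝒬.filter fun X => r ∈ X).card ≤ 1 := by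
          refine Finset.card_le_one.2 fun X hX Y hY => ?_
          rw [Finset.mem_filter] at hX hY
          by_contra hXY
          exact Finset.disjoint_left.1 (hdis X hX.1 Y hY.1 hXY) hX.2 hY.2
        have h5 := Finset.card_filter_add_card_filter_not (s := 𝒬) (fun X => r ∈ X)
        rw [smul_eq_mul] at h3
        have h6 : 𝒮.card + 𝒯.card ≤ (𝒬.filter fun X => r ∉ X).card + 1 := by omega
        nlinarith
      have h2 : 10 * ∑ X ∈ 𝒮, p X + 4 * (m * 𝒯.card) ≤ 8 * e := by
        have h3 := sum_hyperCut_le B 2 hB2 𝒬 hdis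
        have h4 : ∑ X ∈ 𝒮, 10 * p X ≤ ∑ X ∈ 𝒮, 4 * hyperCut B X :=
          Finset.sum_le_sum fun X hX => (hsmall X hX).2.2
        have h5 := Finset.card_nsmul_le_sum 𝒯 (fun X => hyperCut B X) m
          (fun X hX => hcutB X (hne X (Finset.mem_filter.1 hX).1) (hQ X (Finset.mem_filter.1 hX).1))
        rw [← Finset.mul_sum, ← Finset.mul_sum] at h4
        rw [smul_eq_mul, mul_comm] at h5
        omega
      have h3 : k * 𝒮.card ≤ ∑ X ∈ 𝒮, p X := by
        have := Finset.card_nsmul_le_sum 𝒮 p k fun X hX => (hsmall X hX).1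
        rwa [smul_eq_mul, mul_comm] at this
      have h4 : ∑ X ∈ 𝒮, p X ≤ 2 * (k * 𝒮.card) := by
        have := Finset.sum_le_card_nsmul 𝒮 p (2 * k) fun X hX => (hsmall X hX).2.1
        rw [smul_eq_mul] at this
        linarith
      have harith := packing_arith hm h1 h2 h3 h4 (by omega)
      have hpT : ∀ X ∈ 𝒯, p X = if r ∈ X then 0 else k := fun X hX =>
        if_neg (Finset.mem_filter.1 hX).2
      have hpTk : ∀ X ∈ 𝒯, p X ≤ k := fun X hX => by
        rw [hpT X hX]
        split_ifs <;> omega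
      obtain ⟨X₀, hX₀, hrX₀⟩ := hcov r
      rw [← hsum]
      by_cases hs : small X₀
      · have h5 : 1 ≤ 𝒮.card := Finset.card_pos.2 ⟨X₀, Finset.mem_filter.2 ⟨hX₀, hs⟩⟩
        have h6 := Finset.sum_le_card_nsmul 𝒯 p k hpTk
        rw [smul_eq_mul, mul_comm] at h6
        change ∑ X ∈ 𝒯, p X ≤ _ at h6
        have := harith.1 h5
        omega
      · have hX₀T : X₀ ∈ 𝒯 := Finset.mem_filter.2 ⟨hX₀, hs⟩
        have h5 : 1 ≤ 𝒯.card := Finset.card_pos.2 ⟨X₀, hX₀T⟩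
        have h6 := Finset.sum_le_card_nsmul (𝒯.erase X₀) p k fun X hX =>
          hpTk X (Finset.mem_of_mem_erase hX)
        have h7 := Finset.add_sum_erase 𝒯 p hX₀T
        change ∑ X ∈ 𝒯.erase X₀, p X ≤ _ at h6
        have h8 : p X₀ = 0 := by rw [hpT X₀ hX₀T, if_pos hrX₀]
        rw [smul_eq_mul, mul_comm, Finset.card_erase_of_mem hX₀T, Nat.mul_sub, mul_one] at h6
        have h9 := harith.2 h5
        have : k ≤ k * 𝒯.card := Nat.le_mul_of_pos_right k h5
        omega)
  refine ⟨B, h', hBA, hh', hB2, fun X hX hr => ?_, fun u => ?_⟩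
  · refine le_trans ?_ (hp' X hX)
    have := hpbase X
    rwa [if_neg hr] at this
  · by_cases hu : res u < k
    · left
      have h1 := hp' {u} (by simp)
      have h2 : p {u} = 2 * k - res u := by
        have : small {u} := ⟨by simp, by simpa using hu⟩
        simp [p, this]
      have h3 : res u = (Finset.univ.filter fun i => u ∈ A i \ B i).card := rfl
      omega
    · exact .inr (not_lt.1 hu)

/-- A hypergraph of rank at most three all of whose cuts have at least `11 * k / 2` hyperedges
contains `k` disjoint connected spanning graphs, obtained by shrinking hyperedges to pairs, which
leave at least `k` hyperedge ends free at each vertex. -/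
theorem exists_hypergraph_packing (hα : 2 ≤ Fintype.card α) (A : ι → Finset α)
    (hA : ∀ i, (A i).Nonempty) (hA3 : ∀ i, (A i).card ≤ 3) (k : ℕ) (hk : 8 ≤ k)
    (hcut : ∀ X : Finset α, X.Nonempty → X ≠ Finset.univ → 11 * k / 2 ≤ hyperCut A X) :
    ∃ (col : ι → Option (Fin k)) (x y : ι → α), (∀ i, x i ∈ A i) ∧ (∀ i, y i ∈ A i) ∧
      (∀ i, col i ≠ none → x i ≠ y i) ∧
      (∀ j u w, Relation.ReflTransGen
        (fun a b => ∃ i, col i = some j ∧ (x i = a ∧ y i = b ∨ x i = b ∧ y i = a)) u w) ∧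
      ∀ u, k ≤ (Finset.univ.filter fun i =>
        u ∈ A i ∧ ¬ (col i ≠ none ∧ (u = x i ∨ u = y i))).card := by
  classical
  obtain ⟨r⟩ : Nonempty α := Fintype.card_pos_iff.1 (by omega)
  obtain ⟨B, h, hBA, hhB, hB2, hcutB, hfree⟩ :=
    exists_balanced_orientation hα A hA hA3 k hk hcut r
  have htail : ∀ i, ∃ t ∈ B i, ∀ X : Finset α, h i ∈ X → ¬ B i ⊆ X → t ∉ X := by
    intro i
    by_cases hc : ∃ t ∈ B i, t ≠ h i
    · obtain ⟨t, ht, hth⟩ := hc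
      refine ⟨t, ht, fun X hhX hBX htX => hBX ?_⟩
      have : ({t, h i} : Finset α) = B i := by
        refine Finset.eq_of_subset_of_card_le (by simp [Finset.insert_subset_iff, ht, hhB]) ?_
        rw [Finset.card_pair hth]
        exact hB2 i
      rw [← this]
      simp [Finset.insert_subset_iff, htX, hhX]
    · push Not at hc
      exact ⟨h i, hhB i, fun X hhX hBX => absurd (fun t ht => hc t ht ▸ hhX) hBX⟩
  choose t htB htX using htail
  obtain ⟨C, hCD, hdis, hreach, hdeg⟩ := exists_disjoint_arborescences t h r k
    (Finset.univ.filter fun i => t i ≠ h i) (by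
      intro X hX hr
      refine (hcutB X hX hr).trans (Finset.card_le_card fun i hi => ?_)
      simp only [Finset.mem_filter, Finset.mem_univ, true_and] at hi ⊢
      have := htX i X hi.1 hi.2
      exact ⟨fun h => this (h ▸ hi.1), hi.1, this⟩)
  obtain ⟨col, hcol⟩ : ∃ col : ι → Option (Fin k), ∀ i j, col i = some j ↔ i ∈ C j := by
    refine ⟨fun i => if hi : ∃ j, i ∈ C j then some hi.choose else none, fun i j => ?_⟩
    dsimp only
    split_ifs with hi
    · refine ⟨fun hj => Option.some_injective _ hj ▸ hi.choose_spec, fun hj => ?_⟩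
      by_contra hne
      exact Finset.disjoint_left.1 (hdis _ j fun h' => hne (by rw [h'])) hi.choose_spec hj
    · exact ⟨fun h => by simp at h, fun hj => absurd ⟨j, hj⟩ hi⟩
  have hsome : ∀ i, col i ≠ none → ∃ j, i ∈ C j := fun i hi => by
    obtain ⟨j, hj⟩ := Option.ne_none_iff_exists'.1 hi
    exact ⟨j, (hcol i j).1 hj⟩
  refine ⟨col, t, h, fun i => hBA i (htB i), fun i => hBA i (hhB i), fun i hi => ?_,
    fun j => ?_, fun u => ?_⟩
  · obtain ⟨j, hj⟩ := hsome i hi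
    exact (Finset.mem_filter.1 (hCD j hj)).2
  · have hr : ∀ u, Relation.ReflTransGen
        (fun a b => ∃ i, col i = some j ∧ (t i = a ∧ h i = b ∨ t i = b ∧ h i = a)) r u := fun u =>
      Relation.ReflTransGen.mono
        (fun a b ⟨i, hi, hab⟩ => ⟨i, (hcol i j).2 hi, .inl hab⟩) _ _ (hreach j u)
    have hsymm : Std.Symm fun a b => ∃ i, col i = some j ∧
        (t i = a ∧ h i = b ∨ t i = b ∧ h i = a) :=
      ⟨fun a b ⟨i, hi, hab⟩ => ⟨i, hi, hab.symm⟩⟩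
    exact fun u w => .trans (Std.Symm.symm _ _ (hr u)) (hr w)
  · have hres : (Finset.univ.filter fun i => u ∈ A i \ B i) ⊆
        Finset.univ.filter fun i => u ∈ A i ∧ ¬ (col i ≠ none ∧ (u = t i ∨ u = h i)) := by
      intro i hi
      simp only [Finset.mem_filter, Finset.mem_univ, true_and, Finset.mem_sdiff] at hi ⊢
      refine ⟨hi.1, ?_⟩
      rintro ⟨-, rfl | rfl⟩
      · exact hi.2 (htB i)
      · exact hi.2 (hhB i)
    rcases hfree u with h2k | hk'
    · let U := Finset.univ.biUnion fun j => (C j).filter fun i => h i = u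
      have hU : U.card ≤ k := by
        refine Finset.card_biUnion_le.trans ((Finset.sum_le_sum fun j _ => hdeg j u).trans ?_)
        simp
      have hdisj : Disjoint ((Finset.univ.filter fun i => h i ∈ ({u} : Finset α) ∧
          ¬ B i ⊆ {u}) \ U) (Finset.univ.filter fun i => u ∈ A i \ B i) := by
        refine Finset.disjoint_left.2 fun i hi hi' => ?_
        simp only [Finset.mem_filter, Finset.mem_sdiff, Finset.mem_singleton] at hi hi'
        exact hi'.2.2 (hi.1.2.1 ▸ hhB i)
      have hsub : ((Finset.univ.filter fun i => h i ∈ ({u} : Finset α) ∧ ¬ B i ⊆ {u}) \ U) ⊆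
          Finset.univ.filter fun i => u ∈ A i ∧ ¬ (col i ≠ none ∧ (u = t i ∨ u = h i)) := by
        intro i hi
        simp only [Finset.mem_filter, Finset.mem_sdiff, Finset.mem_singleton, Finset.mem_univ,
          true_and] at hi ⊢
        refine ⟨hi.1.1 ▸ hBA i (hhB i), fun hc => hi.2 ?_⟩
        obtain ⟨j, hj⟩ := hsome i hc.1
        exact Finset.mem_biUnion.2 ⟨j, Finset.mem_univ j, Finset.mem_filter.2 ⟨hj, hi.1.1⟩⟩
      have h1 := Finset.card_le_card (Finset.union_subset hsub hres)
      rw [Finset.card_union_of_disjoint hdisj] at h1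
      have h2 := Finset.le_card_sdiff U
        (Finset.univ.filter fun i => h i ∈ ({u} : Finset α) ∧ ¬ B i ⊆ {u})
      omega
    · exact hk'.trans (Finset.card_le_card hres)

end HypergraphPacking

open Classical in
lemma ncard_eq_sum_indicator {E : Type} [Fintype E] (M : Set E) :
    M.ncard = ∑ e, if e ∈ M then 1 else 0 := by
  rw [Set.ncard_eq_toFinset_card', ← Finset.card_filter]
  congr 1
  ext e
  simp

lemma mem_cutEdges_iff {V E : Type} {ends : E → Sym2 V} {F : Set E} {X : Set V} {e : E} {x y : V}
    (he : ends e = s(x, y)) : e ∈ cutEdges ends F X ↔ e ∈ F ∧ ¬ (x ∈ X ↔ y ∈ X) := by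
  simp only [cutEdges, Set.mem_ofPred_eq, he, Sym2.mem_iff, exists_eq_or_imp, exists_eq_left]
  tauto

lemma cutEdges_compl {V E : Type} (ends : E → Sym2 V) (F : Set E) (X : Set V) :
    cutEdges ends F Xᶜ = cutEdges ends F X := by
  ext e
  obtain ⟨x, y, he⟩ := (Sym2.exists (α := V) (f := fun z => ends e = z)).1 ⟨_, rfl⟩
  rw [mem_cutEdges_iff he, mem_cutEdges_iff he, Set.mem_compl_iff, Set.mem_compl_iff]
  tauto

/-- `X` separates two vertices of `T`. -/
def Separates {V : Type} (X T : Set V) : Prop := (∃ t ∈ T, t ∈ X) ∧ ∃ t ∈ T, t ∉ X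

lemma Separates.compl {V : Type} {X T : Set V} (h : Separates X T) : Separates Xᶜ T :=
  ⟨h.2, h.1.imp fun _ ht => ⟨ht.1, not_not.2 ht.2⟩⟩

section Splitting

variable {V E : Type} {ends : E → Sym2 V} {F : Set E} {T : Set V}

lemma cut_uncrossing_pair [Finite E] (X Y : Set V) (M : Set E)
    (hM : ∀ e ∈ M, e ∈ F ∧ ∃ z x, ends e = s(z, x) ∧ z ∉ X ∪ Y ∧ x ∈ X ∩ Y) :
    (cutEdges ends F (X \ Y)).ncard + (cutEdges ends F (Y \ X)).ncard + 2 * M.ncard ≤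
      (cutEdges ends F X).ncard + (cutEdges ends F Y).ncard := by
  classical
  have := Fintype.ofFinite E
  simp only [ncard_eq_sum_indicator, Finset.mul_sum, ← Finset.sum_add_distrib]
  refine Finset.sum_le_sum fun e _ => ?_
  by_cases he : e ∈ M
  · obtain ⟨heF, z, x, hzx, hz, hx⟩ := hM e he
    simp only [mem_cutEdges_iff hzx, Set.mem_sdiff, Set.mem_union, Set.mem_inter_iff] at hz hx ⊢
    push Not at hz
    simp [he, heF, hz, hx]
  · obtain ⟨x, y, hxy⟩ := (Sym2.exists (α := V) (f := fun z => ends e = z)).1 ⟨_, rfl⟩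
    simp only [mem_cutEdges_iff hxy, Set.mem_sdiff, if_neg he]
    grind

lemma cut_uncrossing_triple [Finite E] (X Y Z : Set V) (M : Set E)
    (hM : ∀ e ∈ M, e ∈ F ∧ ∃ z x, ends e = s(z, x) ∧ z ∉ X ∪ Y ∪ Z ∧ x ∈ X ∩ Y ∩ Z) :
    (cutEdges ends F (X ∩ Y ∩ Z)).ncard + (cutEdges ends F (X \ (Y ∪ Z))).ncard +
        (cutEdges ends F (Y \ (X ∪ Z))).ncard + (cutEdges ends F (Z \ (X ∪ Y))).ncard +
        2 * M.ncard ≤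
      (cutEdges ends F X).ncard + (cutEdges ends F Y).ncard + (cutEdges ends F Z).ncard := by
  classical
  have := Fintype.ofFinite E
  simp only [ncard_eq_sum_indicator, Finset.mul_sum, ← Finset.sum_add_distrib]
  refine Finset.sum_le_sum fun e _ => ?_
  by_cases he : e ∈ M
  · obtain ⟨heF, z, x, hzx, hz, hx⟩ := hM e he
    simp only [mem_cutEdges_iff hzx, Set.mem_sdiff, Set.mem_union, Set.mem_inter_iff] at hz hx ⊢
    push Not at hz
    simp [he, heF, hz, hx]
  · obtain ⟨x, y, hxy⟩ := (Sym2.exists (α := V) (f := fun z => ends e = z)).1 ⟨_, rfl⟩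
    simp only [mem_cutEdges_iff hxy, Set.mem_sdiff, Set.mem_inter_iff, Set.mem_union, if_neg he]
    by_cases h0 : e ∈ F
    · by_cases h1 : x ∈ X <;> by_cases h2 : x ∈ Y <;> by_cases h3 : x ∈ Z <;>
        by_cases h4 : y ∈ X <;> by_cases h5 : y ∈ Y <;> by_cases h6 : y ∈ Z <;>
        simp [h0, h1, h2, h3, h4, h5, h6]
    · simp [h0]

/-- A set of vertices avoiding `z` whose cut would become too small if two edges joining `z` to it
were split off. -/
structure Dangerous (ends : E → Sym2 V) (F : Set E) (T : Set V) (N : ℕ) (z : V) (X : Set V) :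
    Prop where
  notMem : z ∉ X
  separates : Separates X T
  cut_le : (cutEdges ends F X).ncard ≤ N + 1

/-- The edges of `F` joining `z` to `X`. -/
def edgesTo (ends : E → Sym2 V) (F : Set E) (z : V) (X : Set V) : Set E :=
  {e ∈ F | ∃ x ∈ X, ends e = s(z, x)}

lemma edgesTo_inter (z : V) (X Y : Set V) :
    edgesTo ends F z X ∩ edgesTo ends F z Y = edgesTo ends F z (X ∩ Y) := by
  ext e
  constructor
  · rintro ⟨⟨heF, x, hx, hex⟩, -, y, hy, hey⟩
    rw [hex, Sym2.congr_right] at hey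
    exact ⟨heF, x, ⟨hx, hey ▸ hy⟩, hex⟩
  · rintro ⟨heF, x, hx, hex⟩
    exact ⟨⟨heF, x, hx.1, hex⟩, heF, x, hx.2, hex⟩

variable {N : ℕ} {z : V}

lemma Dangerous.two_mul_card_le [Finite E] (hz : z ∉ T)
    (hcut : ∀ X, Separates X T → N ≤ (cutEdges ends F X).ncard)
    (hF : ∀ e ∈ F, z ∈ ends e → ∃ x ∈ T, ends e = s(z, x)) {X : Set V}
    (hX : Dangerous ends F T N z X) :
    2 * (edgesTo ends F z X).ncard ≤ (edgesTo ends F z T).ncard + 1 := by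
  classical
  have := Fintype.ofFinite E
  have h1 := hcut (insert z X) ⟨hX.separates.1.imp fun t ht => ⟨ht.1, .inr ht.2⟩, by
    obtain ⟨t, ht, htX⟩ := hX.separates.2
    refine ⟨t, ht, ?_⟩
    rintro (rfl | h)
    · exact hz ht
    · exact htX h⟩
  have h2 : (cutEdges ends F (insert z X)).ncard + 2 * (edgesTo ends F z X).ncard ≤
      (cutEdges ends F X).ncard + (edgesTo ends F z T).ncard := by
    simp only [ncard_eq_sum_indicator, Finset.mul_sum, ← Finset.sum_add_distrib]
    refine Finset.sum_le_sum fun e _ => ?_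
    by_cases he : e ∈ F ∧ z ∈ ends e
    · obtain ⟨x, hxT, hx⟩ := hF e he.1 he.2
      have hxz : x ≠ z := fun h => hz (h ▸ hxT)
      have h3 : e ∈ edgesTo ends F z T := ⟨he.1, x, hxT, hx⟩
      have h4 : e ∈ edgesTo ends F z X ↔ x ∈ X := by
        refine ⟨?_, fun h => ⟨he.1, x, h, hx⟩⟩
        rintro ⟨-, y, hy, hey⟩
        rw [hx, Sym2.congr_right] at hey
        exact hey ▸ hy
      simp only [mem_cutEdges_iff hx, h3, h4, he.1, Set.mem_insert_iff, hX.notMem, hxz]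
      by_cases h5 : x ∈ X <;> simp [h5]
    · have h3 : ∀ Y, e ∉ edgesTo ends F z Y := by
        rintro Y ⟨heF, y, -, hey⟩
        exact he ⟨heF, by simp [hey]⟩
      have h4 : e ∈ cutEdges ends F (insert z X) ↔ e ∈ cutEdges ends F X := by
        obtain ⟨x, y, hxy⟩ := (Sym2.exists (α := V) (f := fun z => ends e = z)).1 ⟨_, rfl⟩
        rw [mem_cutEdges_iff hxy, mem_cutEdges_iff hxy]
        rw [hxy, Sym2.mem_iff] at he
        simp only [Set.mem_insert_iff]
        grind
      simp [h3, h4]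
  have := hX.cut_le
  omega

lemma Dangerous.pair_false [Finite E] (hcut : ∀ X, Separates X T → N ≤ (cutEdges ends F X).ncard)
    (hF : ∀ e ∈ F, z ∈ ends e → ∃ x ∈ T, ends e = s(z, x)) {X Y : Set V}
    (hX : Dangerous ends F T N z X) (hY : Dangerous ends F T N z Y)
    (hXY : 2 ≤ (edgesTo ends F z X ∩ edgesTo ends F z Y).ncard) {g h : E}
    (hgX : g ∈ edgesTo ends F z X) (hgY : g ∉ edgesTo ends F z Y)
    (hhX : h ∉ edgesTo ends F z X) (hhY : h ∈ edgesTo ends F z Y) : False := by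
  rw [edgesTo_inter] at hXY
  have h1 := cut_uncrossing_pair (ends := ends) (F := F) X Y (edgesTo ends F z (X ∩ Y)) (by
    rintro e ⟨heF, x, hx, hex⟩
    exact ⟨heF, z, x, hex, by simp [hX.notMem, hY.notMem], hx⟩)
  obtain ⟨e, heF, x, hx, hex⟩ : (edgesTo ends F z (X ∩ Y)).Nonempty :=
    Set.nonempty_of_ncard_ne_zero (by omega)
  have hxT : ∀ {e x}, e ∈ F → ends e = s(z, x) → x ∈ T := by
    intro e x heF hex
    obtain ⟨y, hy, hey⟩ := hF e heF (by simp [hex])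
    rw [hex, Sym2.congr_right] at hey
    exact hey ▸ hy
  obtain ⟨hgF, a, ha, hga⟩ := hgX
  obtain ⟨hhF, b, hb, hhb⟩ := hhY
  have h2 := hcut (X \ Y) ⟨⟨a, hxT hgF hga, ha, fun h => hgY ⟨hgF, a, h, hga⟩⟩,
    ⟨x, hxT heF hex, fun h => h.2 hx.2⟩⟩
  have h3 := hcut (Y \ X) ⟨⟨b, hxT hhF hhb, hb, fun h => hhX ⟨hhF, b, h, hhb⟩⟩,
    ⟨x, hxT heF hex, fun h => h.2 hx.1⟩⟩
  have := hX.cut_le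
  have := hY.cut_le
  omega

lemma Dangerous.triple_false [Finite E] (hcut : ∀ X, Separates X T → N ≤ (cutEdges ends F X).ncard)
    (hF : ∀ e ∈ F, z ∈ ends e → ∃ x ∈ T, ends e = s(z, x)) (hN : 2 ≤ N) {X : Fin 3 → Set V}
    (hX : ∀ i, Dangerous ends F T N z (X i)) {f : E} (hf : ∀ i, f ∈ edgesTo ends F z (X i))
    {g : Fin 3 → E} (hg : ∀ i j, g i ∈ edgesTo ends F z (X j) ↔ i = j) : False := by
  have hxT : ∀ {e x}, e ∈ F → ends e = s(z, x) → x ∈ T := by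
    intro e x heF hex
    obtain ⟨y, hy, hey⟩ := hF e heF (by simp [hex])
    rw [hex, Sym2.congr_right] at hey
    exact hey ▸ hy
  choose a ha hga using fun i => ((hg i i).2 rfl).2
  have hgF : ∀ i, g i ∈ F := fun i => ((hg i i).2 rfl).1
  have haT : ∀ i, a i ∈ T := fun i => hxT (hgF i) (hga i)
  have haX : ∀ i j, i ≠ j → a i ∉ X j := fun i j hij h =>
    hij ((hg i j).1 ⟨hgF i, a i, h, hga i⟩)
  obtain ⟨hfF, x, -, hfx⟩ := hf 0
  have hxX : ∀ i, x ∈ X i := by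
    intro i
    obtain ⟨-, y, hy, hey⟩ := hf i
    rw [hfx, Sym2.congr_right] at hey
    exact hey ▸ hy
  have hxT' := hxT hfF hfx
  have h1 := cut_uncrossing_triple (ends := ends) (F := F) (X 0) (X 1) (X 2) {f} (by
    rintro e rfl
    exact ⟨hfF, z, x, hfx, by simp [(hX _).notMem], by simp [hxX]⟩)
  rw [Set.ncard_singleton] at h1
  have h2 := hcut (X 0 ∩ X 1 ∩ X 2) ⟨⟨x, hxT', by simp [hxX]⟩,
    ⟨a 0, haT 0, fun h => haX 0 1 (by decide) h.1.2⟩⟩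
  have h3 := hcut (X 0 \ (X 1 ∪ X 2)) ⟨⟨a 0, haT 0, ha 0, by simp [haX]⟩,
    ⟨x, hxT', by simp [hxX]⟩⟩
  have h4 := hcut (X 1 \ (X 0 ∪ X 2)) ⟨⟨a 1, haT 1, ha 1, by simp [haX]⟩,
    ⟨x, hxT', by simp [hxX]⟩⟩
  have h5 := hcut (X 2 \ (X 0 ∪ X 1)) ⟨⟨a 2, haT 2, ha 2, by simp [haX]⟩,
    ⟨x, hxT', by simp [hxX]⟩⟩
  have := (hX 0).cut_le
  have := (hX 1).cut_le
  have := (hX 2).cut_le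
  omega

/-- Some pair of edges at `z` lies in no dangerous set. -/
lemma exists_safe_pair [Finite E] (hz : z ∉ T) (hN : 2 ≤ N)
    (hcut : ∀ X, Separates X T → N ≤ (cutEdges ends F X).ncard)
    (hF : ∀ e ∈ F, z ∈ ends e → ∃ x ∈ T, ends e = s(z, x))
    (hdeg : 4 ≤ (edgesTo ends F z T).ncard) :
    ∃ e ∈ edgesTo ends F z T, ∃ f ∈ edgesTo ends F z T, e ≠ f ∧
      ∀ X, Dangerous ends F T N z X → e ∈ edgesTo ends F z X → f ∉ edgesTo ends F z X := by
  by_contra! hcon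
  have hETE : ∀ X e, e ∈ edgesTo ends F z X → e ∈ edgesTo ends F z T := by
    rintro X e ⟨heF, x, -, hex⟩
    obtain ⟨y, hy, hey⟩ := hF e heF (by simp [hex])
    exact ⟨heF, y, hy, hey⟩
  obtain ⟨e, f, he, hf, hef⟩ := (Set.one_lt_ncard_iff (Set.toFinite _)).1 (by omega :
    1 < (edgesTo ends F z T).ncard)
  obtain ⟨X₁, hX₁, -⟩ := hcon e he f hf hef
  obtain ⟨X, hX, hmax⟩ : ∃ X, Dangerous ends F T N z X ∧ ∀ Y, Dangerous ends F T N z Y →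
      (edgesTo ends F z Y).ncard ≤ (edgesTo ends F z X).ncard := by
    have hb : BddAbove
        ((fun X => (edgesTo ends F z X).ncard) '' {X | Dangerous ends F T N z X}) := by
      refine ⟨(edgesTo ends F z T).ncard, ?_⟩
      rintro _ ⟨Y, -, rfl⟩
      exact Set.ncard_le_ncard (hETE Y) (Set.toFinite _)
    obtain ⟨X, hX, hXs⟩ := Nat.sSup_mem ⟨_, Set.mem_image_of_mem _ hX₁⟩ hb
    refine ⟨X, hX, fun Y hY => ?_⟩
    simp only at hXs
    rw [hXs]
    exact le_csSup hb (Set.mem_image_of_mem _ hY)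
  have h2 := hX.two_mul_card_le hz hcut hF
  by_cases h3 : 3 ≤ (edgesTo ends F z X).ncard
  · obtain ⟨s, hsX, hs⟩ := Set.exists_subset_card_eq h3
    obtain ⟨a, b, c, hab, hac, hbc, rfl⟩ := Set.ncard_eq_three.1 hs
    obtain ⟨f, hfT, hfX⟩ := Set.exists_mem_notMem_of_ncard_lt_ncard
      (by omega : (edgesTo ends F z X).ncard < (edgesTo ends F z T).ncard)
    have hex : ∀ i : Fin 3, ∃ Y, Dangerous ends F T N z Y ∧ ![a, b, c] i ∈ edgesTo ends F z Y ∧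
        f ∈ edgesTo ends F z Y := by
      intro i
      have hi : ![a, b, c] i ∈ edgesTo ends F z X := hsX (by fin_cases i <;> simp)
      exact hcon _ (hETE X _ hi) f hfT fun h => hfX (h ▸ hi)
    choose Y hY hgY hfY using hex
    refine Dangerous.triple_false hcut hF hN hY hfY (g := ![a, b, c]) fun i j => ⟨fun hij => ?_,
      fun hij => hij ▸ hgY i⟩
    by_contra hne
    have hiX : ∀ i, ![a, b, c] i ∈ edgesTo ends F z X :=
      fun i => hsX (by fin_cases i <;> simp)
    have hinj : ![a, b, c] i ≠ ![a, b, c] j := by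
      fin_cases i <;> fin_cases j <;> simp_all [eq_comm]
    have hcommon : 2 ≤ (edgesTo ends F z X ∩ edgesTo ends F z (Y j)).ncard := by
      rw [← Set.ncard_pair hinj]
      refine Set.ncard_le_ncard ?_ (Set.toFinite _)
      rintro _ (rfl | rfl)
      · exact ⟨hiX i, hij⟩
      · exact ⟨hiX j, hgY j⟩
    have hpriv : ¬ edgesTo ends F z X ⊆ edgesTo ends F z (Y j) := by
      intro hsub
      have h4 := Set.ncard_le_ncard (Set.insert_subset (hfY j) hsub) (Set.toFinite _)
      rw [Set.ncard_insert_of_notMem hfX (Set.toFinite _)] at h4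
      have := hmax _ (hY j)
      omega
    obtain ⟨g, hgX, hgYj⟩ := Set.not_subset.1 hpriv
    exact Dangerous.pair_false hcut hF hX (hY j) hcommon hgX hgYj hfX (hfY j)
  · obtain ⟨s, hsT, hs⟩ := Set.exists_subset_card_eq hdeg
    obtain ⟨f, hf⟩ : s.Nonempty := Set.nonempty_of_ncard_ne_zero (by omega)
    have hs3 : (s \ {f}).ncard = 3 := by
      rw [Set.ncard_sdiff_singleton_of_mem hf, hs]
    obtain ⟨a, b, c, hab, hac, hbc, habc⟩ := Set.ncard_eq_three.1 hs3
    have hmem : ∀ i : Fin 3, ![a, b, c] i ∈ s \ {f} := by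
      intro i
      rw [habc]
      fin_cases i <;> simp
    choose Y hY hgY hfY using fun i : Fin 3 => hcon _ (hsT (hmem i).1) f (hsT hf) (hmem i).2
    refine Dangerous.triple_false hcut hF hN hY hfY (g := ![a, b, c]) fun i j => ⟨fun hij => ?_,
      fun hij => hij ▸ hgY i⟩
    by_contra hne
    have hinj : ![a, b, c] i ≠ ![a, b, c] j := by
      fin_cases i <;> fin_cases j <;> simp_all [eq_comm]
    have h4 : ({f, ![a, b, c] i, ![a, b, c] j} : Set E).ncard = 3 :=
      Set.ncard_eq_three.2 ⟨_, _, _, fun h => (hmem i).2 h.symm, fun h => (hmem j).2 h.symm,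
        hinj, rfl⟩
    have h5 : ({f, ![a, b, c] i, ![a, b, c] j} : Set E) ⊆ edgesTo ends F z (Y j) := by
      rintro _ (rfl | rfl | rfl)
      · exact hfY j
      · exact hij
      · exact hgY j
    have h6 := Set.ncard_le_ncard h5 (Set.toFinite _)
    have h7 := hmax _ (hY j)
    omega

end Splitting

section Lifting

variable {V E : Type} {ends : E → Sym2 V} {F : Set E} {T : Set V}

/-- `k` disjoint subgraphs of `F` connecting `T` and leaving `k` edges of `F` unused at each vertex
of `T`. -/
def SparePacking (ends : E → Sym2 V) (F : Set E) (T : Set V) (k : ℕ) : Prop :=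
  ∃ H : Fin k → Set E, (∀ i, H i ⊆ F) ∧ PairwiseEdgeDisjoint H ∧
    (∀ i, ConnectsSet ends (H i) T) ∧
    ∀ u ∈ T, k ≤ {g | g ∈ F ∧ u ∈ ends g ∧ ∀ i, g ∉ H i}.ncard

open Classical in
lemma SparePacking.of_split [Finite E] {k : ℕ} {e f : E} {x y z : V} (heF : e ∈ F) (hfF : f ∈ F)
    (hef : e ≠ f) (he : ends e = s(z, x)) (hf : ends f = s(z, y)) (hz : z ∉ T)
    (h : SparePacking (Function.update ends e s(x, y)) (F \ {f}) T k) :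
    SparePacking ends F T k := by
  obtain ⟨H, hHF, hdis, hconn, hfree⟩ := h
  have hfH : ∀ i, f ∉ H i := fun i hi => (hHF i hi).2 rfl
  refine ⟨fun i => H i ∪ {g | g = f ∧ e ∈ H i}, ?_, ?_, ?_, ?_⟩
  · rintro i g (hg | ⟨rfl, -⟩)
    · exact (hHF i hg).1
    · exact hfF
  · intro i j hij
    rw [Set.disjoint_left]
    rintro g (hg | ⟨rfl, hg⟩) (hg' | ⟨hgf, hg'⟩)
    · exact Set.disjoint_left.1 (hdis i j hij) hg hg'
    · exact hfH i (hgf ▸ hg)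
    · exact hfH j hg'
    · exact Set.disjoint_left.1 (hdis i j hij) hg hg'
  · intro i a ha b hb
    have h1 := hconn i a ha b hb
    clear ha hb
    induction h1 with
    | refl => exact .refl
    | @tail b c _ hbc ih =>
      refine ih.trans ?_
      obtain ⟨g, hg, hgb⟩ := hbc
      by_cases hge : g = e
      · subst hge
        rw [Function.update_self] at hgb
        have h2 : ∀ w, ends g = s(z, w) → Step ends (H i ∪ {g' | g' = f ∧ g ∈ H i}) z w :=
          fun w hw => ⟨g, .inl hg, hw⟩
        have h3 : Step ends (H i ∪ {g' | g' = f ∧ g ∈ H i}) z y := ⟨f, .inr ⟨rfl, hg⟩, hf⟩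
        have h4 : Step ends (H i ∪ {g' | g' = f ∧ g ∈ H i}) x z := ⟨g, .inl hg, by
          rw [he, Sym2.eq_swap]⟩
        have h5 : Step ends (H i ∪ {g' | g' = f ∧ g ∈ H i}) y z := ⟨f, .inr ⟨rfl, hg⟩, by
          rw [hf, Sym2.eq_swap]⟩
        rw [Sym2.eq_iff] at hgb
        rcases hgb with ⟨rfl, rfl⟩ | ⟨rfl, rfl⟩
        · exact .head h4 (.single h3)
        · exact .head h5 (.single (h2 _ he))
      · rw [Function.update_of_ne hge] at hgb
        exact .single ⟨g, .inl hg, hgb⟩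
  · intro u hu
    have huz : u ≠ z := fun h => hz (h ▸ hu)
    refine (hfree u hu).trans ?_
    refine Set.ncard_le_ncard_of_injOn (fun g => if g = e ∧ u ∉ ends e then f else g) ?_ ?_
      (Set.toFinite _)
    · rintro g ⟨⟨hgF, hgf⟩, hgu, hgH⟩
      by_cases hge : g = e
      · subst hge
        rw [Function.update_self] at hgu
        by_cases hu' : u ∈ ends g
        · simp only [hu', not_true_eq_false, and_false, if_false]
          refine ⟨hgF, hu', fun i => ?_⟩
          rintro (h | ⟨rfl, -⟩)
          · exact hgH i h
          · exact hef rfl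
        · simp only [hu', not_false_eq_true, and_true, if_true]
          refine ⟨hfF, ?_, fun i => ?_⟩
          · rw [hf, Sym2.mem_iff]
            rw [he, Sym2.mem_iff] at hu'
            rw [Sym2.mem_iff] at hgu
            tauto
          · rintro (h | ⟨-, h⟩)
            · exact hfH i h
            · exact hgH i h
      · rw [Function.update_of_ne hge] at hgu
        simp only [hge, false_and, if_false]
        refine ⟨hgF, hgu, fun i => ?_⟩
        rintro (h | ⟨rfl, -⟩)
        · exact hgH i h
        · exact hgf rfl
    · rintro g ⟨⟨-, hgf⟩, -⟩ g' ⟨⟨-, hgf'⟩, -⟩ hgg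
      simp only [Set.mem_singleton_iff] at hgf hgf'
      grind

open Classical in
lemma exists_split [Finite E] {N : ℕ} {z : V} (hz : z ∉ T) (hN : 2 ≤ N)
    (hcut : ∀ X, Separates X T → N ≤ (cutEdges ends F X).ncard)
    (hF : ∀ e ∈ F, ∃ x ∈ T, x ∈ ends e) (hdeg : 4 ≤ (edgesTo ends F z T).ncard) :
    ∃ e ∈ F, ∃ f ∈ F, ∃ x y, e ≠ f ∧ ends e = s(z, x) ∧ ends f = s(z, y) ∧ x ∈ T ∧
      ∀ X, Separates X T →
        N ≤ (cutEdges (Function.update ends e s(x, y)) (F \ {f}) X).ncard := by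
  obtain ⟨e, ⟨heF, x, hxT, hex⟩, f, ⟨hfF, y, hyT, hfy⟩, hef, hsafe⟩ :=
    exists_safe_pair hz hN hcut (by
      intro e heF hze
      obtain ⟨x, hxT, hx⟩ := hF e heF
      exact ⟨x, hxT, (Sym2.mem_and_mem_iff (fun h : z = x => hz (h ▸ hxT))).1 ⟨hze, hx⟩⟩) hdeg
  refine ⟨e, heF, f, hfF, x, y, hef, hex, hfy, hxT, ?_⟩
  have key : ∀ X, z ∉ X → Separates X T →
      N ≤ (cutEdges (Function.update ends e s(x, y)) (F \ {f}) X).ncard := by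
    intro X hzX hX
    have hne : ∀ g, g ≠ e → g ≠ f → (g ∈ cutEdges ends F X ↔
        g ∈ cutEdges (Function.update ends e s(x, y)) (F \ {f}) X) := by
      intro g hge hgf
      simp only [cutEdges, Set.mem_ofPred_eq, Function.update_of_ne hge, Set.mem_sdiff,
        Set.mem_singleton_iff, hgf, not_false_eq_true, and_true]
    have he1 : e ∈ cutEdges ends F X ↔ x ∈ X := by
      rw [mem_cutEdges_iff hex]
      tauto
    have hf1 : f ∈ cutEdges ends F X ↔ y ∈ X := by
      rw [mem_cutEdges_iff hfy]
      tauto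
    have he2 : e ∈ cutEdges (Function.update ends e s(x, y)) (F \ {f}) X ↔ ¬ (x ∈ X ↔ y ∈ X) := by
      rw [mem_cutEdges_iff (Function.update_self _ _ _)]
      exact and_iff_right ⟨heF, hef⟩
    have hNX := hcut X hX
    by_cases hxy : x ∈ X ∧ y ∈ X
    · have h1 : N + 2 ≤ (cutEdges ends F X).ncard := by
        by_contra! h
        exact hsafe X ⟨hzX, hX, by omega⟩ ⟨heF, x, hxy.1, hex⟩ ⟨hfF, y, hxy.2, hfy⟩
      have h2 : cutEdges ends F X ⊆ insert e (insert f
          (cutEdges (Function.update ends e s(x, y)) (F \ {f}) X)) := by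
        intro g hg
        by_cases hge : g = e
        · exact .inl hge
        by_cases hgf : g = f
        · exact .inr (.inl hgf)
        exact .inr (.inr ((hne g hge hgf).1 hg))
      have h3 := Set.ncard_le_ncard h2 (Set.toFinite _)
      have h4 := Set.ncard_insert_le e (insert f
          (cutEdges (Function.update ends e s(x, y)) (F \ {f}) X))
      have h5 := Set.ncard_insert_le f
          (cutEdges (Function.update ends e s(x, y)) (F \ {f}) X)
      omega
    · refine hNX.trans (Set.ncard_le_ncard_of_injOn (fun g => if g = f then e else g) ?_ ?_
        (Set.toFinite _))
      · intro g hg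
        by_cases hgf : g = f
        · subst hgf
          simp only [if_true]
          exact he2.2 (by tauto)
        by_cases hge : g = e
        · subst hge
          simp only [hgf, if_false]
          exact he2.2 (by tauto)
        simp only [hgf, if_false]
        exact (hne g hge hgf).1 hg
      · intro g hg g' hg' hgg
        simp only at hgg
        grind
  intro X hX
  by_cases hzX : z ∈ X
  · rw [← cutEdges_compl]
    exact key _ (fun h => h hzX) hX.compl
  · exact key X hzX hX

end Lifting

section GraphPacking

variable {V E : Type} {ends : E → Sym2 V} {F : Set E} {T : Set V}

open Classical in
/-- The hypergraph on `T` obtained from `F` by regarding every vertex outside `T` as the hyperedge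
of its neighbours in `T`. -/
noncomputable def hyperedge [Finite V] (ends : E → Sym2 V) (F : Set E) (T : Set V) :
    E ⊕ V → Finset T :=
  have := Fintype.ofFinite V
  Sum.elim (fun e => Finset.univ.filter fun t => e ∈ F ∧ (∀ w ∈ ends e, w ∈ T) ∧ t.1 ∈ ends e)
    fun z => Finset.univ.filter fun t => z ∉ T ∧ ∃ e ∈ F, ends e = s(z, t.1)

lemma mem_hyperedge_inl [Finite V] {e : E} {t : T} :
    t ∈ hyperedge ends F T (.inl e) ↔ e ∈ F ∧ (∀ w ∈ ends e, w ∈ T) ∧ t.1 ∈ ends e := by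
  simp [hyperedge]

lemma mem_hyperedge_inr [Finite V] {z : V} {t : T} :
    t ∈ hyperedge ends F T (.inr z) ↔ z ∉ T ∧ ∃ e ∈ F, ends e = s(z, t.1) := by
  simp [hyperedge]

/-- `e` realises the incidence of `t` with the hyperedge `i`. -/
def Realises (ends : E → Sym2 V) (F : Set E) (T : Set V) (i : E ⊕ V) (t : T) (e : E) : Prop :=
  e ∈ F ∧ t.1 ∈ ends e ∧ ((i = .inl e ∧ ∀ w ∈ ends e, w ∈ T) ∨
    ∃ z, i = .inr z ∧ z ∉ T ∧ ends e = s(z, t.1))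

lemma exists_realises [Finite V] {i : E ⊕ V} {t : T} (h : t ∈ hyperedge ends F T i) :
    ∃ e, Realises ends F T i t e := by
  rcases i with e | z
  · obtain ⟨h1, h2, h3⟩ := mem_hyperedge_inl.1 h
    exact ⟨e, h1, h3, .inl ⟨rfl, h2⟩⟩
  · obtain ⟨h1, e, h2, h3⟩ := mem_hyperedge_inr.1 h
    exact ⟨e, h2, by simp [h3], .inr ⟨z, rfl, h1, h3⟩⟩

lemma Realises.unique {i i' : E ⊕ V} {t t' : T} {e : E} (h : Realises ends F T i t e)
    (h' : Realises ends F T i' t' e) : i = i' := by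
  obtain ⟨-, -, ⟨rfl, h1⟩ | ⟨z, rfl, h1, h2⟩⟩ := h <;>
    obtain ⟨-, -, ⟨rfl, h3⟩ | ⟨z', rfl, h3, h4⟩⟩ := h'
  · rfl
  · exact absurd (h1 z' (by simp [h4])) h3
  · exact absurd (h3 z (by simp [h2])) h1
  · rw [h2, Sym2.eq_iff] at h4
    rcases h4 with ⟨rfl, -⟩ | ⟨rfl, -⟩
    · rfl
    · exact absurd t'.2 h1

lemma Realises.eq_or_eq {i : E ⊕ V} {t x y : T} {e f : E} (h : Realises ends F T i t e)
    (hx : Realises ends F T i x e) (hy : Realises ends F T i y f) (hxy : x ≠ y) :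
    t = x ∨ t = y := by
  obtain ⟨-, ht, ⟨rfl, h1⟩ | ⟨z, rfl, h1, h2⟩⟩ := h
  · obtain ⟨-, hy1, ⟨h3, -⟩ | ⟨z, h3, -⟩⟩ := hy
    · cases h3
      rw [(Sym2.mem_and_mem_iff (fun h => hxy (Subtype.ext h))).1 ⟨hx.2.1, hy1⟩, Sym2.mem_iff] at ht
      exact ht.imp Subtype.ext Subtype.ext
    · simp at h3
  · obtain ⟨-, -, ⟨h3, -⟩ | ⟨z', h3, -, h4⟩⟩ := hx
    · simp at h3
    · cases h3
      rw [h2, Sym2.congr_right] at h4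
      exact .inl (Subtype.ext h4)

lemma Realises.reaches {i : E ⊕ V} {x y : T} {e f : E} (hx : Realises ends F T i x e)
    (hy : Realises ends F T i y f) (hxy : x ≠ y) {M : Set E} (he : e ∈ M) (hf : f ∈ M) :
    Reaches ends M x y := by
  obtain ⟨-, hx1, ⟨rfl, h1⟩ | ⟨z, rfl, h1, h2⟩⟩ := hx
  · obtain ⟨-, hy1, ⟨h3, -⟩ | ⟨z, h3, -⟩⟩ := hy
    · cases h3
      exact .single ⟨e, he,
        (Sym2.mem_and_mem_iff (fun h => hxy (Subtype.ext h))).1 ⟨hx1, hy1⟩⟩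
    · simp at h3
  · obtain ⟨-, -, ⟨h3, -⟩ | ⟨z', h3, -, h4⟩⟩ := hy
    · simp at h3
    · cases h3
      exact .head ⟨e, he, by rw [h2, Sym2.eq_swap]⟩ (.single ⟨f, hf, h4⟩)

lemma card_hyperedge_le [Finite V] [Finite E]
    (hdeg : ∀ z, z ∉ T → (edgesTo ends F z T).ncard ≤ 3) (i : E ⊕ V) :
    (hyperedge ends F T i).card ≤ 3 := by
  classical
  rcases i with e | z
  · obtain ⟨x, y, hxy⟩ := (Sym2.exists (α := V) (f := fun z => ends e = z)).1 ⟨_, rfl⟩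
    rw [← Finset.card_map (Function.Embedding.subtype _)]
    refine (Finset.card_le_card (t := {x, y}) ?_).trans (Finset.card_le_two.trans (by norm_num))
    intro w hw
    obtain ⟨t, ht, rfl⟩ := Finset.mem_map.1 hw
    have := (mem_hyperedge_inl.1 ht).2.2
    rw [hxy, Sym2.mem_iff] at this
    simpa using this
  · by_cases hz : z ∈ T
    · rw [Finset.card_eq_zero.2 (Finset.eq_empty_of_forall_notMem fun t ht =>
        (mem_hyperedge_inr.1 ht).1 hz)]
      norm_num
    have := Fintype.ofFinite E
    refine le_trans ?_ (hdeg z hz)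
    rw [Set.ncard_eq_toFinset_card']
    refine Finset.card_le_card_of_forall_subsingleton (fun t e => ends e = s(z, t.1)) ?_ ?_
    · intro t ht
      obtain ⟨-, e, heF, he⟩ := mem_hyperedge_inr.1 ht
      exact ⟨e, by simpa using ⟨heF, t.1, t.2, he⟩, he⟩
    · intro e _ t ht t' ht'
      have h1 : ends e = s(z, t.1) := ht.2
      have h2 : ends e = s(z, t'.1) := ht'.2
      rw [h1, Sym2.congr_right] at h2
      exact Subtype.ext h2

open Classical in
lemma le_hyperCut [Finite V] [Finite E] {N : ℕ}
    (hcut : ∀ X, Separates X T → N ≤ (cutEdges ends F X).ncard)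
    (hF : ∀ e ∈ F, ∃ x ∈ T, x ∈ ends e)
    (hdeg : ∀ z, z ∉ T → (edgesTo ends F z T).ncard ≤ 3)
    [Fintype {i : E ⊕ V // (hyperedge ends F T i).Nonempty}] [Fintype T] (X : Finset T)
    (hX : X.Nonempty) (hX' : X ≠ Finset.univ) :
    N ≤ hyperCut (fun i : {i // (hyperedge ends F T i).Nonempty} => hyperedge ends F T i) X := by
  let XV : Set V := {w | ∃ t ∈ X, t.1 = w}
  let YV : Set V := {w | ∃ t ∉ X, t.1 = w}
  have hsum : ∀ z, z ∉ T → (edgesTo ends F z XV).ncard + (edgesTo ends F z YV).ncard ≤ 3 := by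
    intro z hz
    rw [← Set.ncard_union_eq]
    · refine (Set.ncard_le_ncard ?_ (Set.toFinite _)).trans (hdeg z hz)
      rintro e (⟨he, _, ⟨t, -, rfl⟩, het⟩ | ⟨he, _, ⟨t, -, rfl⟩, het⟩) <;> exact ⟨he, t.1, t.2, het⟩
    · rw [Set.disjoint_left]
      rintro e ⟨he, _, ⟨t, ht, rfl⟩, het⟩ ⟨-, _, ⟨t', ht', rfl⟩, het'⟩
      rw [het, Sym2.congr_right] at het'
      exact ht' (Subtype.ext het' ▸ ht)
  let Z : Set V := {w | w ∈ XV ∨ w ∉ T ∧ (edgesTo ends F w YV).ncard < (edgesTo ends F w XV).ncard}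
  have hZT : ∀ t : T, t.1 ∈ Z ↔ t ∈ X := by
    intro t
    constructor
    · rintro (⟨t', ht', h⟩ | ⟨h, -⟩)
      · exact Subtype.ext h ▸ ht'
      · exact absurd t.2 h
    · exact fun h => .inl ⟨t, h, rfl⟩
  have hZz : ∀ z, z ∉ T →
      (z ∈ Z ↔ (edgesTo ends F z YV).ncard < (edgesTo ends F z XV).ncard) := by
    intro z hz
    constructor
    · rintro (⟨t', -, rfl⟩ | ⟨-, h⟩)
      · exact absurd t'.2 hz
      · exact h
    · exact fun h => .inr ⟨hz, h⟩
  have hsep : Separates Z T := by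
    obtain ⟨t, ht⟩ := hX
    obtain ⟨t', ht'⟩ := not_forall.1 fun h => hX' (Finset.eq_univ_iff_forall.2 h)
    exact ⟨⟨t, t.2, (hZT t).2 ht⟩, ⟨t', t'.2, fun h => ht' ((hZT t').1 h)⟩⟩
  refine (hcut Z hsep).trans ?_
  have := Fintype.ofFinite E
  rw [Set.ncard_eq_toFinset_card', hyperCut]
  have hshape : ∀ e ∈ F, (∀ w ∈ ends e, w ∈ T) ∨ ∃ z, z ∉ T ∧ ∃ t : T, ends e = s(z, t.1) := by
    intro e he
    by_cases h : ∀ w ∈ ends e, w ∈ T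
    · exact .inl h
    · push Not at h
      obtain ⟨z, hze, hz⟩ := h
      obtain ⟨x, hx, hxe⟩ := hF e he
      exact .inr ⟨z, hz, ⟨x, hx⟩,
        (Sym2.mem_and_mem_iff (fun h : z = x => hz (h ▸ hx))).1 ⟨hze, hxe⟩⟩
  refine Finset.card_le_card_of_forall_subsingleton
    (fun e i => i.1 = .inl e ∨ ∃ z ∈ ends e, i.1 = .inr z ∧ z ∉ T) ?_ ?_
  · intro e he
    rw [Set.mem_toFinset] at he
    obtain ⟨heF, ⟨a, ha, haZ⟩, b, hb, hbZ⟩ := he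
    rcases hshape e heF with h | ⟨z, hz, t, het⟩
    · have ha' : (⟨a, h a ha⟩ : T) ∈ hyperedge ends F T (.inl e) := mem_hyperedge_inl.2 ⟨heF, h, ha⟩
      have hb' : (⟨b, h b hb⟩ : T) ∈ hyperedge ends F T (.inl e) := mem_hyperedge_inl.2 ⟨heF, h, hb⟩
      refine ⟨⟨.inl e, ⟨_, ha'⟩⟩,
        Finset.mem_filter.2 ⟨Finset.mem_univ _, ⟨_, ha', ?_⟩, ?_⟩, .inl rfl⟩
      · exact (hZT ⟨a, h a ha⟩).1 haZ
      · exact fun hsub => hbZ ((hZT ⟨b, h b hb⟩).2 (hsub hb'))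
    · have hmem : ∀ W : Set V, 0 < (edgesTo ends F z W).ncard →
          ∃ f ∈ F, ∃ w ∈ W, ends f = s(z, w) := by
        intro W hW
        obtain ⟨f, hf, w, hw, hfw⟩ := Set.nonempty_of_ncard_ne_zero hW.ne'
        exact ⟨f, hf, w, hw, hfw⟩
      have hXY : 0 < (edgesTo ends F z XV).ncard ∧ 0 < (edgesTo ends F z YV).ncard := by
        rw [het, Sym2.mem_iff] at ha hb
        have hpos : ∀ W : Set V, t.1 ∈ W → 0 < (edgesTo ends F z W).ncard := fun W hW =>
          (Set.ncard_pos (Set.toFinite _)).2 ⟨e, heF, t.1, hW, het⟩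
        by_cases htX : t ∈ X
        · have h1 := hpos XV ⟨t, htX, rfl⟩
          have h2 : z ∉ Z := by
            rcases hb with rfl | rfl
            · exact hbZ
            · exact absurd ((hZT t).2 htX) hbZ
          rw [hZz z hz] at h2
          exact ⟨h1, by omega⟩
        · have h1 := hpos YV ⟨t, htX, rfl⟩
          have h2 : z ∈ Z := by
            rcases ha with rfl | rfl
            · exact haZ
            · exact absurd ((hZT t).1 haZ) htX
          rw [hZz z hz] at h2
          exact ⟨by omega, h1⟩
      obtain ⟨f, hf, _, ⟨p, hp, rfl⟩, hfp⟩ := hmem _ hXY.1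
      obtain ⟨g, hg, _, ⟨q, hq, rfl⟩, hgq⟩ := hmem _ hXY.2
      have hp' : p ∈ hyperedge ends F T (.inr z) := mem_hyperedge_inr.2 ⟨hz, f, hf, hfp⟩
      have hq' : q ∈ hyperedge ends F T (.inr z) := mem_hyperedge_inr.2 ⟨hz, g, hg, hgq⟩
      exact ⟨⟨.inr z, ⟨_, hp'⟩⟩, Finset.mem_filter.2 ⟨Finset.mem_univ _, ⟨p, hp', hp⟩,
        fun hsub => hq (hsub hq')⟩, .inr ⟨z, by simp [het], rfl, hz⟩⟩
  · rintro ⟨i, hi⟩ - e he e' he'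
    simp only [Set.mem_toFinset] at he he'
    obtain ⟨he, hei⟩ := he
    obtain ⟨he', hei'⟩ := he'
    rcases hei with rfl | ⟨z, hze, rfl, hz⟩
    · rcases hei' with h | ⟨z, -, h, -⟩
      · exact Sum.inl_injective h
      · simp at h
    · rcases hei' with h | ⟨z', hze', h, -⟩
      · simp at h
      · cases h
        have hside : ∀ f ∈ cutEdges ends F Z, z ∈ ends f →
            (z ∈ Z → f ∈ edgesTo ends F z YV) ∧ (z ∉ Z → f ∈ edgesTo ends F z XV) := by
          rintro f hf hzf
          obtain ⟨x, hx, hxf⟩ := hF f hf.1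
          have hfx := (Sym2.mem_and_mem_iff (fun h : z = x => hz (h ▸ hx))).1 ⟨hzf, hxf⟩
          have h1 := ((mem_cutEdges_iff hfx).1 hf).2
          have h2 : x ∈ Z ↔ _ := hZT ⟨x, hx⟩
          refine ⟨fun h => ⟨hf.1, x, ⟨⟨x, hx⟩, by tauto, rfl⟩, hfx⟩,
            fun h => ⟨hf.1, x, ⟨⟨x, hx⟩, by tauto, rfl⟩, hfx⟩⟩
        have h3 := hsum z hz
        have h4 := hZz z hz
        by_cases hzZ : z ∈ Z
        · exact (Set.ncard_le_one (Set.toFinite _)).1 (by have := h4.1 hzZ; omega) e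
            ((hside e he hze).1 hzZ) e' ((hside e' he' hze').1 hzZ)
        · exact (Set.ncard_le_one (Set.toFinite _)).1
            (by have := mt h4.2 hzZ; omega : (edgesTo ends F z XV).ncard ≤ 1) e
            ((hside e he hze).2 hzZ) e' ((hside e' he' hze').2 hzZ)

lemma sparePacking_of_card_edgesTo_le [Finite V] [Finite E] {k : ℕ} (hk : 8 ≤ k)
    (hT : 2 ≤ T.ncard) (hcut : ∀ X, Separates X T → 11 * k / 2 ≤ (cutEdges ends F X).ncard)
    (hF : ∀ e ∈ F, ∃ x ∈ T, x ∈ ends e)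
    (hdeg : ∀ z, z ∉ T → (edgesTo ends F z T).ncard ≤ 3) : SparePacking ends F T k := by
  classical
  have := Fintype.ofFinite T
  have := Fintype.ofFinite {i : E ⊕ V // (hyperedge ends F T i).Nonempty}
  obtain ⟨col, x, y, hx, hy, hxy, hconn, hfree⟩ := exists_hypergraph_packing
    (by rwa [← Nat.card_eq_fintype_card])
    (fun i : {i : E ⊕ V // (hyperedge ends F T i).Nonempty} => hyperedge ends F T i)
    (fun i => i.2) (fun i => card_hyperedge_le hdeg i) k hk (le_hyperCut hcut hF hdeg)
  have : Nonempty E := by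
    obtain ⟨a, b, ha, hb, hab⟩ := (Set.one_lt_ncard_iff (Set.finite_of_ncard_pos (by omega))).1 hT
    obtain ⟨e, -⟩ : (cutEdges ends F {a}).Nonempty := Set.nonempty_of_ncard_ne_zero (by
      have := hcut {a} ⟨⟨a, ha, rfl⟩, b, hb, hab.symm⟩
      omega)
    exact ⟨e⟩
  choose! c hc using fun (i : E ⊕ V) (t : T) (h : t ∈ hyperedge ends F T i) => exists_realises h
  have hcx := fun i => hc _ _ (hx i)
  have hcy := fun i => hc _ _ (hy i)
  refine ⟨fun j => {g | ∃ i, col i = some j ∧ (g = c i (x i) ∨ g = c i (y i))}, ?_, ?_, ?_, ?_⟩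
  · rintro j _ ⟨i, -, rfl | rfl⟩
    · exact (hcx i).1
    · exact (hcy i).1
  · intro j j' hjj
    rw [Set.disjoint_left]
    rintro g ⟨i, hij, hg⟩ ⟨i', hij', hg'⟩
    have h1 : ∃ t, Realises ends F T i t g := by
      rcases hg with rfl | rfl
      exacts [⟨_, hcx i⟩, ⟨_, hcy i⟩]
    have h2 : ∃ t, Realises ends F T i' t g := by
      rcases hg' with rfl | rfl
      exacts [⟨_, hcx i'⟩, ⟨_, hcy i'⟩]
    obtain ⟨_, h1⟩ := h1
    obtain ⟨_, h2⟩ := h2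
    obtain rfl := Subtype.ext (h1.unique h2)
    rw [hij] at hij'
    exact hjj (Option.some_injective _ hij')
  · intro j a ha b hb
    have h1 := hconn j ⟨a, ha⟩ ⟨b, hb⟩
    suffices ∀ t : T, Relation.ReflTransGen (fun a b => ∃ i, col i = some j ∧
        (x i = a ∧ y i = b ∨ x i = b ∧ y i = a)) ⟨a, ha⟩ t →
        Reaches ends {g | ∃ i, col i = some j ∧ (g = c i (x i) ∨ g = c i (y i))} a t from
      this _ h1
    intro t ht
    induction ht with
    | refl => exact .refl
    | tail _ h ih =>
      refine ih.trans ?_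
      obtain ⟨i, hij, ⟨rfl, rfl⟩ | ⟨rfl, rfl⟩⟩ := h
      · exact (hcx i).reaches (hcy i) (hxy i (by simp [hij])) ⟨i, hij, .inl rfl⟩ ⟨i, hij, .inr rfl⟩
      · exact (hcy i).reaches (hcx i) (hxy i (by simp [hij])).symm ⟨i, hij, .inr rfl⟩
          ⟨i, hij, .inl rfl⟩
  · intro u hu
    refine (hfree ⟨u, hu⟩).trans ?_
    rw [← Set.ncard_coe_finset]
    refine Set.ncard_le_ncard_of_injOn (fun i => c i ⟨u, hu⟩) ?_ ?_ (Set.toFinite _)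
    · intro i hi
      rw [Finset.mem_coe, Finset.mem_filter] at hi
      obtain ⟨-, hui, hi⟩ := hi
      have hcu := hc _ _ hui
      refine ⟨hcu.1, hcu.2.1, fun j => ?_⟩
      rintro ⟨i', hij, hg⟩
      have h1 : i = i' := by
        rcases hg with hg | hg
        · exact Subtype.ext (hcu.unique (hg ▸ hcx i'))
        · exact Subtype.ext (hcu.unique (hg ▸ hcy i'))
      subst h1
      have hne := hxy i (by simp [hij])
      refine hi ⟨by simp [hij], ?_⟩
      rcases hg with hg | hg
      · exact hcu.eq_or_eq (hg ▸ hcx i) (hcy i) hne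
      · exact (hcu.eq_or_eq (hg ▸ hcy i) (hcx i) hne.symm).symm
    · intro i hi i' hi' hii
      rw [Finset.mem_coe, Finset.mem_filter] at hi hi'
      have h1 := hc _ _ hi.2.1
      have h2 := hc _ _ hi'.2.1
      simp only at hii
      exact Subtype.ext (h1.unique (hii ▸ h2))

/-- A set `T` meeting every edge of `F` and `⌊5.5 k⌋`-edge-connected in `F` is connected by `k`
disjoint subgraphs of `F` leaving `k` edges unused at each vertex of `T`. -/
theorem exists_sparePacking [Finite V] [Finite E] {k : ℕ} (hk : 8 ≤ k) (hT : 2 ≤ T.ncard)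
    (hcut : ∀ X, Separates X T → 11 * k / 2 ≤ (cutEdges ends F X).ncard)
    (hF : ∀ e ∈ F, ∃ x ∈ T, x ∈ ends e) : SparePacking ends F T k := by
  classical
  induction hn : F.ncard using Nat.strong_induction_on generalizing ends F with
  | _ n ih =>
    by_cases hdeg : ∀ z, z ∉ T → (edgesTo ends F z T).ncard ≤ 3
    · exact sparePacking_of_card_edgesTo_le hk hT hcut hF hdeg
    · push Not at hdeg
      obtain ⟨z, hz, hdeg⟩ := hdeg
      obtain ⟨e, heF, f, hfF, x, y, hef, he, hf, hxT, hcut'⟩ :=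
        exists_split hz (by omega) hcut hF hdeg
      refine .of_split heF hfF hef he hf hz (ih (F \ {f}).ncard ?_ hcut' ?_ rfl)
      · rw [← hn]
        exact Set.ncard_sdiff_singleton_lt_of_mem hfF (Set.toFinite _)
      · rintro g ⟨hg, -⟩
        by_cases hge : g = e
        · subst hge
          exact ⟨x, hxT, by simp⟩
        · rw [Function.update_of_ne hge]
          exact hF g hg

end GraphPacking

section Collapse

variable {V E : Type} {ends : E → Sym2 V} {Y : Set V} {y p : V}

lemma Reaches.symm {F : Set E} {a b : V} (h : Reaches ends F a b) : Reaches ends F b a := by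
  have : Std.Symm (Step ends F) := ⟨fun a b ⟨e, he, h⟩ => ⟨e, he, by rw [h, Sym2.eq_swap]⟩⟩
  exact Std.Symm.symm (r := Relation.ReflTransGen (Step ends F)) _ _ h

lemma Reaches.mono {F F' : Set E} {a b : V} (h : Reaches ends F a b) (hF : F ⊆ F') :
    Reaches ends F' a b :=
  Relation.ReflTransGen.mono (fun _ _ ⟨e, he, h⟩ => ⟨e, hF he, h⟩) _ _ h

lemma exists_ends (ends : E → Sym2 V) (e : E) : ∃ a b, ends e = s(a, b) :=
  (Sym2.exists (α := V) (f := fun z => ends e = z)).1 ⟨_, rfl⟩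

open Classical in
/-- Contract `Y` to the vertex `y`, turning the edges inside `Y` into loops at `p`. -/
noncomputable def collapse (ends : E → Sym2 V) (Y : Set V) (y p : V) (e : E) : Sym2 V :=
  if ∀ x ∈ ends e, x ∈ Y then s(p, p) else (ends e).map fun x => if x ∈ Y then y else x

open Classical in
lemma collapse_eq {e : E} {a b : V} (he : ends e = s(a, b)) :
    collapse ends Y y p e = if a ∈ Y ∧ b ∈ Y then s(p, p) else
      s(if a ∈ Y then y else a, if b ∈ Y then y else b) := by
  simp [collapse, he]

open Classical in
lemma cutEdges_collapse (X : Set V) : cutEdges (collapse ends Y y p) Set.univ X =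
    cutEdges ends Set.univ {x | (if x ∈ Y then y else x) ∈ X} := by
  ext e
  obtain ⟨a, b, he⟩ := exists_ends ends e
  have h := collapse_eq (Y := Y) (y := y) (p := p) he
  rw [mem_cutEdges_iff he]
  by_cases hab : a ∈ Y ∧ b ∈ Y
  · rw [if_pos hab] at h
    rw [mem_cutEdges_iff h]
    simp [hab.1, hab.2]
  · rw [if_neg hab] at h
    rw [mem_cutEdges_iff h]
    rfl

lemma incEdges_collapse_of_notMem (hy : y ∈ Y) (hp : p ∈ Y) {u : V} (hu : u ∉ Y) :
    incEdges (collapse ends Y y p) u = incEdges ends u := by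
  classical
  ext e
  obtain ⟨a, b, he⟩ := exists_ends ends e
  simp only [incEdges, Set.mem_ofPred_eq, collapse_eq he, he]
  grind

lemma incEdges_collapse_self (hy : y ∈ Y) (hp : p ≠ y) :
    incEdges (collapse ends Y y p) y = cutEdges ends Set.univ Y := by
  classical
  ext e
  obtain ⟨a, b, he⟩ := exists_ends ends e
  rw [mem_cutEdges_iff he]
  simp only [incEdges, Set.mem_ofPred_eq, collapse_eq he, Set.mem_univ, true_and]
  grind

lemma not_isDiag_of_collapse {e : E} (h : ¬ (collapse ends Y y p e).IsDiag) :
    ¬ (ends e).IsDiag := by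
  classical
  obtain ⟨a, b, he⟩ := exists_ends ends e
  rw [collapse_eq he] at h
  rw [he, Sym2.mk_isDiag_iff]
  rintro rfl
  split_ifs at h <;> simp at h

lemma extMeasure_collapse_lt [Finite E] {e : E} (he : ∀ x ∈ ends e, x ∈ Y)
    (hne : ¬ (ends e).IsDiag) : extMeasure (collapse ends Y y p) < extMeasure ends := by
  refine Nat.add_lt_add_left (Set.ncard_lt_ncard ⟨fun f => not_isDiag_of_collapse, fun h => ?_⟩
    (Set.toFinite _)) _
  have : ¬ (collapse ends Y y p e).IsDiag := h hne
  rw [collapse, if_pos he] at this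
  simp at this

lemma not_isDiag_collapse_of_mem (hy : y ∈ Y) (hp : p ∈ Y) {u : V} (hu : u ∉ Y)
    (hl : ∀ e, u ∈ ends e → ¬ (ends e).IsDiag) (e : E) (he : u ∈ collapse ends Y y p e) :
    ¬ (collapse ends Y y p e).IsDiag := by
  classical
  have h1 : e ∈ incEdges ends u := incEdges_collapse_of_notMem hy hp hu ▸ he
  have h2 := hl e h1
  obtain ⟨a, b, hab⟩ := exists_ends ends e
  have h1' : u ∈ ends e := h1
  rw [hab, Sym2.mem_iff] at h1'
  rw [hab, Sym2.mk_isDiag_iff] at h2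
  rw [collapse_eq hab]
  rw [if_neg (by rintro ⟨h3, h4⟩; rcases h1' with rfl | rfl <;> contradiction), Sym2.mk_isDiag_iff]
  grind

lemma not_isDiag_collapse_of_mem_self (hy : y ∈ Y) (hp : p ≠ y) (e : E)
    (he : y ∈ collapse ends Y y p e) : ¬ (collapse ends Y y p e).IsDiag := by
  classical
  have h1 : e ∈ cutEdges ends Set.univ Y := incEdges_collapse_self hy hp ▸ he
  obtain ⟨a, b, hab⟩ := exists_ends ends e
  rw [mem_cutEdges_iff hab] at h1
  rw [collapse_eq hab, if_neg (by tauto), Sym2.mk_isDiag_iff]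
  grind

/-- The terminals of the contracted graph. -/
def collapseTerminals (S Y : Set V) (y : V) : Set V := {s | s ∈ S ∧ s ∉ Y ∨ s = y}

lemma edgeConnectedIn_collapse [Finite V] [Finite E] {S : Set V} {n : ℕ}
    (h : EdgeConnectedIn ends Set.univ S n) (hy : y ∈ Y) (hyS : y ∈ S) :
    EdgeConnectedIn (collapse ends Y y p) Set.univ (collapseTerminals S Y y) n := by
  classical
  have hfix : ∀ s ∈ collapseTerminals S Y y, s ∈ S ∧ (if s ∈ Y then y else s) = s := by
    rintro s (hs | rfl)
    · exact ⟨hs.1, if_neg hs.2⟩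
    · exact ⟨hyS, if_pos hy⟩
  intro a ha b hb hab
  refine edgeDisjointPathsIn_univ_of_cut fun X haX hbX => ?_
  rw [cutEdges_collapse]
  refine (h a (hfix a ha).1 b (hfix b hb).1 hab).le_cut ?_ ?_
  · rwa [Set.mem_ofPred_eq, (hfix a ha).2]
  · rwa [Set.mem_ofPred_eq, (hfix b hb).2]

/-- Edges inside a tight set exist as soon as some crossing edge misses the chosen terminal. -/
lemma exists_nonloop_inside [Finite E] {S : Set V} {n : ℕ} (h : EdgeConnectedIn ends Set.univ S n)
    (hy : y ∈ Y) (hyS : y ∈ S) {s : V} (hs : s ∈ S) (hsY : s ∉ Y)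
    (hcut : (cutEdges ends Set.univ Y).ncard ≤ n) {e : E} (he : e ∈ cutEdges ends Set.univ Y)
    (hey : y ∉ ends e) : ∃ f, (∀ x ∈ ends f, x ∈ Y) ∧ ¬ (ends f).IsDiag := by
  by_contra! hcon
  have h1 := (h y hyS s hs (fun h => hsY (h ▸ hy))).le_cut (X := {y}) rfl
    (fun h : s = y => hsY (h ▸ hy))
  have h2 : cutEdges ends Set.univ {y} ⊂ cutEdges ends Set.univ Y := by
    refine ⟨fun f hf => ?_, fun h => ?_⟩
    · obtain ⟨a, b, hab⟩ := exists_ends ends f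
      have h3 := hcon f
      rw [mem_cutEdges_iff hab] at hf ⊢
      simp only [hab, Sym2.mem_iff, Sym2.mk_isDiag_iff, Set.mem_singleton_iff] at h3 hf
      grind
    · obtain ⟨-, ⟨x, hx, rfl⟩, -⟩ := h he
      exact hey hx
  have := Set.ncard_lt_ncard h2 (Set.toFinite _)
  omega

/-- The packing that a minimal counterexample provides on the contraction of a tight set. -/
lemma MinExtCex.exists_packing_collapse [Finite V] [Finite E] {Q k : ℕ} {S R : Set V} {v : V}
    {P : Fin k → Set E} (hmin : MinExtCex Q k ends S R v P) (hy : y ∈ Y) (hyS : y ∈ S)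
    (hp : p ∈ Y) {s : V} (hs : s ∈ S) (hsY : s ∉ Y)
    (hcut : (cutEdges ends Set.univ Y).ncard = Q * k) {e : E} (he : e ∈ cutEdges ends Set.univ Y)
    (hep : y ∉ ends e) {w : V} (hw : w ∈ collapseTerminals S Y y)
    (hdeg : deg (collapse ends Y y p) w = Q * k)
    (hl : ∀ e, w ∈ collapse ends Y y p e → ¬ (collapse ends Y y p e).IsDiag) {P' : Fin k → Set E}
    (hP : IsBalancedSubpartitionAt (collapse ends Y y p) w P') (hP2 : ∀ i, 2 ≤ (P' i).ncard) :
    ∃ H : Fin k → Set E, PairwiseEdgeDisjoint H ∧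
      (∀ i, ConnectsSet (collapse ends Y y p) (H i) (collapseTerminals S Y y)) ∧
      BalanceSet (collapse ends Y y p) H (collapseTerminals S Y y ∪ R \ Y) ∧
      Extend (collapse ends Y y p) w P' H := by
  obtain ⟨⟨hQ, hk, hSR, -, hconn, hR, -⟩, hmin⟩ := hmin
  by_contra hcon
  obtain ⟨f, hfY, hf⟩ := exists_nonloop_inside hconn hy hyS hs hsY hcut.le he hep
  refine (extMeasure_collapse_lt (y := y) (p := p) hfY hf).not_ge
    (hmin V E inferInstance inferInstance _ (collapseTerminals S Y y) (R \ Y) w P'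
      ⟨hQ, hk, ?_, ?_, edgeConnectedIn_collapse hconn hy hyS, ?_, hw, hl, hdeg, hP, hP2, hcon⟩)
  · rw [Set.disjoint_left]
    rintro x (hx | rfl) hxR
    · exact Set.disjoint_left.1 hSR hx.1 hxR.1
    · exact hxR.2 hy
  · exact (Set.one_lt_ncard_iff (Set.toFinite _)).2
      ⟨s, y, .inl ⟨hs, hsY⟩, .inr rfl, fun h => hsY (h ▸ hy)⟩
  · intro r hr
    rw [deg, incEdges_collapse_of_notMem hy hp hr.2]
    exact hR r hr.1

end Collapse

section Gluing

variable {V E : Type} {ends : E → Sym2 V} {S R Y : Set V} {v y z z' : V} {Q k : ℕ}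
  {P : Fin k → Set E}

lemma reaches_avoiding {H : Set E} (h : ¬ IsCutVertexOf ends H v) {a b : V} (ha : a ≠ v)
    (hb : b ≠ v) (hab : Reaches ends H a b) : Reaches ends {e ∈ H | v ∉ ends e} a b :=
  by_contra fun hn => h ⟨a, b, ha, hb, hab, hn⟩

lemma not_isCutVertexOf {H : Set E} (h : ∀ e ∈ H, ∀ f ∈ H, ∀ a b, a ≠ v → b ≠ v →
    ends e = s(a, v) → ends f = s(b, v) → Reaches ends {e ∈ H | v ∉ ends e} a b) :
    ¬ IsCutVertexOf ends H v := by
  rintro ⟨a, b, ha, hb, hab, hn⟩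
  have key : ∀ c, Reaches ends H a c → (c ≠ v → Reaches ends {e ∈ H | v ∉ ends e} a c) ∧
      (c = v → ∃ n, n ≠ v ∧ Reaches ends {e ∈ H | v ∉ ends e} a n ∧ ∃ e ∈ H, ends e = s(n, v)) := by
    intro c hc
    induction hc with
    | refl => exact ⟨fun _ => .refl, fun h => absurd h ha⟩
    | @tail c d _ hcd ih =>
      obtain ⟨e, heH, he⟩ := hcd
      by_cases hc : c = v
      · subst hc
        refine ⟨fun hd => ?_, fun _ => ih.2 rfl⟩
        obtain ⟨n, hn, han, f, hfH, hf⟩ := ih.2 rfl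
        exact han.trans (h f hfH e heH n d hn hd hf (by rw [he, Sym2.eq_swap]))
      · refine ⟨fun hd => (ih.1 hc).tail ⟨e, ⟨heH, ?_⟩, he⟩, ?_⟩
        · rw [he, Sym2.mem_iff]
          rintro (h | h)
          · exact hc h.symm
          · exact hd h.symm
        · rintro rfl
          exact ⟨c, hc, ih.1 hc, e, heH, he⟩
  exact hn ((key b hab).1 hb)

open Classical in
/-- In a minimal counterexample every edge between two nonterminals crosses a tight cut. -/
lemma MinExtCex.exists_tight_cut [Finite V] [Finite E] (hmin : MinExtCex Q k ends S R v P) {e : E}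
    (he : ends e = s(z, z')) (hzz : z ≠ z') (hz : z ∉ S ∪ R) (hz' : z' ∉ S ∪ R) :
    ∃ Y : Set V, v ∉ Y ∧ (∃ y ∈ S, y ∈ Y) ∧ (cutEdges ends Set.univ Y).ncard = Q * k ∧
      e ∈ cutEdges ends Set.univ Y := by
  obtain ⟨⟨hQ, hk, hSR, hS2, hconn, hR, hvS, hvl, hdeg, hP, hP2, hno⟩, hmin⟩ := hmin
  let ends' := Function.update ends e s(z, z)
  have hne : ∀ f, f ≠ e → ends' f = ends f := fun f hf => Function.update_of_ne hf _ _
  have hee : ends' e = s(z, z) := Function.update_self _ _ _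
  have hinc : ∀ u ∈ S ∪ R, incEdges ends' u = incEdges ends u := by
    intro u hu
    ext f
    by_cases hf : f = e
    · subst hf
      have h1 : u ≠ z := fun h => hz (h ▸ hu)
      have h2 : u ≠ z' := fun h => hz' (h ▸ hu)
      simp [incEdges, hee, he, h1, h2]
    · simp [incEdges, hne f hf]
  have heu : ∀ u ∈ S ∪ R, e ∉ incEdges ends u := by
    intro u hu h
    rw [incEdges, Set.mem_ofPred_eq, he, Sym2.mem_iff] at h
    rcases h with rfl | rfl <;> contradiction
  have hvU : v ∈ S ∪ R := .inl hvS
  have hmeas : extMeasure ends' < extMeasure ends := by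
    refine Nat.add_lt_add_left (Set.ncard_lt_ncard ⟨fun f hf => ?_, fun h => ?_⟩
      (Set.toFinite _)) _
    · by_cases hfe : f = e
      · subst hfe
        simp [hee] at hf
      · rwa [Set.mem_ofPred_eq, hne f hfe] at hf
    · have : e ∈ {f | ¬ (ends' f).IsDiag} := h (by simpa [he] using hzz)
      simp [hee] at this
  have hreach : ∀ M : Set E, ∀ a b, Reaches ends' M a b → Reaches ends (M \ {e}) a b := by
    intro M a b h
    induction h with
    | refl => exact .refl
    | tail _ h ih =>
      obtain ⟨f, hf, hfe⟩ := h
      by_cases hfe' : f = e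
      · subst hfe'
        rw [hee, Sym2.eq_iff] at hfe
        rcases hfe with ⟨rfl, rfl⟩ | ⟨rfl, rfl⟩ <;> exact ih
      · exact ih.tail ⟨f, ⟨hf, hfe'⟩, by rw [← hne f hfe', hfe]⟩
  have hreach' : ∀ M : Set E, ∀ a b, Reaches ends (M \ {e}) a b → Reaches ends' M a b :=
    fun M a b h => Relation.ReflTransGen.mono
      (fun _ _ ⟨f, hf, h⟩ => ⟨f, hf.1, by rw [hne f hf.2, h]⟩) _ _ h
  have hconn' : ¬ EdgeConnectedIn ends' Set.univ S (Q * k) := by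
    intro hc
    refine hmeas.not_ge (hmin V E inferInstance inferInstance ends' S R v P
      ⟨hQ, hk, hSR, hS2, hc, ?_, hvS, ?_, ?_, ?_, hP2, ?_⟩)
    · intro r hr
      rw [deg, hinc r (.inr hr)]
      exact hR r hr
    · intro f hf
      have h1 : f ∈ incEdges ends v := hinc v hvU ▸ hf
      rw [hne f (by rintro rfl; exact heu v hvU h1)]
      exact hvl f h1
    · rwa [deg, hinc v hvU]
    · simpa only [IsBalancedSubpartitionAt, IsBalancedPartitionAt, IsSubpartitionAt, hinc v hvU]
        using hP
    · rintro ⟨H, hdis, hHS, hbal, hext⟩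
      refine hno ⟨fun i => H i \ {e}, fun i j hij => (hdis i j hij).mono Set.sdiff_subset
        Set.sdiff_subset, fun i a ha b hb => hreach _ _ _ (hHS i a ha b hb), ?_, ?_⟩
      · intro u hu
        have h1 := hbal u hu
        have h2 : ∀ i, incEdges ends u ∩ (H i \ {e}) = incEdges ends u ∩ H i := by
          intro i
          ext f
          simp only [Set.mem_inter_iff, Set.mem_sdiff, Set.mem_singleton_iff]
          refine ⟨fun h => ⟨h.1, h.2.1⟩, fun h => ⟨h.1, h.2, ?_⟩⟩
          rintro rfl
          exact heu u hu h.1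
        simp only [BalanceVertex, h2]
        simpa only [BalanceVertex, IsBalancedSubpartitionAt, IsBalancedPartitionAt,
          IsSubpartitionAt, hinc u hu] using h1
      · intro i
        refine ⟨fun f hf => ⟨(hext i).1 hf, ?_⟩, ?_⟩
        · rintro rfl
          exact heu v hvU (hP.1.1 i hf)
        · rintro ⟨a, b, ha, hb, hab, hn⟩
          refine hn ((hreach _ _ _ (reaches_avoiding (hext i).2 ha hb (hreach' _ _ _ hab))).mono ?_)
          rintro f ⟨⟨hf, hfv⟩, hfe⟩
          exact ⟨⟨hf, hfe⟩, by rwa [← hne f hfe]⟩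
  unfold EdgeConnectedIn at hconn'
  push Not at hconn'
  obtain ⟨a, ha, b, hb, hab, hpaths⟩ := hconn'
  have hX : ∃ X : Set V, a ∈ X ∧ b ∉ X ∧ (cutEdges ends' Set.univ X).ncard < Q * k := by
    by_contra! h
    exact hpaths (edgeDisjointPathsIn_univ_of_cut h)
  obtain ⟨X, haX, hbX, hX⟩ := hX
  have h1 := (hconn a ha b hb hab).le_cut haX hbX
  have hsub : ∀ f ∈ cutEdges ends Set.univ X, f ≠ e → f ∈ cutEdges ends' Set.univ X := by
    rintro f ⟨-, hf⟩ hfe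
    rw [← hne f hfe] at hf
    exact ⟨trivial, hf⟩
  have heX : e ∈ cutEdges ends Set.univ X := by
    by_contra heX
    have := Set.ncard_le_ncard (fun f hf => hsub f hf (by rintro rfl; exact heX hf))
      (Set.toFinite (cutEdges ends' Set.univ X))
    omega
  have h2 : (cutEdges ends Set.univ X).ncard = Q * k := by
    have h3 : cutEdges ends Set.univ X ⊆ insert e (cutEdges ends' Set.univ X) := fun f hf =>
      or_iff_not_imp_left.2 (hsub f hf)
    have h4 := Set.ncard_le_ncard h3 (Set.toFinite _)
    have h5 := Set.ncard_insert_le e (cutEdges ends' Set.univ X)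
    omega
  by_cases hvX : v ∈ X
  · exact ⟨Xᶜ, fun h => h hvX, ⟨b, hb, hbX⟩, by rwa [cutEdges_compl], by rwa [cutEdges_compl]⟩
  · exact ⟨X, hvX, ⟨a, ha, haX⟩, h2, heX⟩

/-- The edges of `A` not inside `Y` together with the edges of `B` inside `Y`. -/
def glue (ends : E → Sym2 V) (Y : Set V) (A B : Set E) : Set E :=
  {e | e ∈ A ∧ ¬ (∀ x ∈ ends e, x ∈ Y) ∨ e ∈ B ∧ ∀ x ∈ ends e, x ∈ Y}

lemma reaches_of_collapse_compl {H A : Set E} {a b : V}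
    (h : Reaches (collapse ends Yᶜ v z') {e ∈ H | v ∉ collapse ends Yᶜ v z' e} a b) :
    Reaches ends (glue ends Y A H) a b := by
  classical
  suffices ∀ c d, Step (collapse ends Yᶜ v z') {e ∈ H | v ∉ collapse ends Yᶜ v z' e} c d →
      Reaches ends (glue ends Y A H) c d by
    induction h with
    | refl => exact .refl
    | tail _ hcd ih => exact ih.trans (this _ _ hcd)
  rintro c d ⟨e, ⟨heH, hev⟩, he⟩
  obtain ⟨p, q, hpq⟩ := exists_ends ends e
  rw [collapse_eq hpq] at he hev
  simp only [Set.mem_compl_iff] at he hev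
  by_cases h1 : p ∉ Y ∧ q ∉ Y
  · rw [if_pos h1, Sym2.eq_iff] at he
    rcases he with ⟨rfl, rfl⟩ | ⟨rfl, rfl⟩ <;> exact .refl
  · rw [if_neg h1] at he hev
    have hp : p ∈ Y := by
      by_contra hp
      simp [hp] at hev
    have hq : q ∈ Y := by
      by_contra hq
      simp [hq] at hev
    simp only [hp, hq, not_true_eq_false, if_false] at he
    exact .single ⟨e, .inr ⟨heH, by simp [hpq, hp, hq]⟩, hpq.trans he⟩

/-- A vertex outside `Y`, or on an edge of `H` leaving `Y`. -/
def Attached (ends : E → Sym2 V) (Y : Set V) (H : Set E) (a : V) : Prop :=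
  a ∉ Y ∨ ∃ f ∈ H, f ∈ cutEdges ends Set.univ Y ∧ a ∈ ends f

open Classical in
lemma reaches_glue {H A B : Set E} (hy : y ∈ Y) (hAH : A ⊆ H)
    (hB : ∀ a ∈ Y, ∀ b ∈ Y, Attached ends Y H a → Attached ends Y H b →
      Reaches ends (glue ends Y A B) a b) {a b : V}
    (ha : Attached ends Y H a) (hb : Attached ends Y H b)
    (h : Reaches (collapse ends Y y z) A (if a ∈ Y then y else a) (if b ∈ Y then y else b)) :
    Reaches ends (glue ends Y A B) a b := by
  have hsame : ∀ a b, Attached ends Y H a → Attached ends Y H b →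
      (if a ∈ Y then y else a) = (if b ∈ Y then y else b) → Reaches ends (glue ends Y A B) a b := by
    intro a b ha hb hab
    by_cases haY : a ∈ Y <;> by_cases hbY : b ∈ Y <;> simp only [haY, hbY, if_true, if_false] at hab
    · exact hB a haY b hbY ha hb
    · exact absurd (hab ▸ hy) hbY
    · exact absurd (hab ▸ hy) haY
    · exact hab ▸ .refl
  suffices ∀ q, Reaches (collapse ends Y y z) A (if a ∈ Y then y else a) q → ∀ b,
      Attached ends Y H b → (if b ∈ Y then y else b) = q → Reaches ends (glue ends Y A B) a b from
    this _ h b hb rfl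
  intro q hq
  induction hq with
  | refl => exact fun b hb hab => hsame a b ha hb hab.symm
  | @tail c d _ hcd ih =>
    intro b hb hbd
    obtain ⟨e, heA, he⟩ := hcd
    obtain ⟨p, q, hpq⟩ := exists_ends ends e
    rw [collapse_eq hpq] at he
    by_cases hin : p ∈ Y ∧ q ∈ Y
    · rw [if_pos hin, Sym2.eq_iff] at he
      rcases he with ⟨rfl, rfl⟩ | ⟨rfl, rfl⟩ <;> exact ih b hb hbd
    · rw [if_neg hin, Sym2.eq_iff] at he
      have heg : e ∈ glue ends Y A B := .inl ⟨heA, by simpa [hpq] using hin⟩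
      have hatt : ∀ x ∈ ends e, Attached ends Y H x := by
        intro x hx
        by_cases hxY : x ∈ Y
        · refine .inr ⟨e, hAH heA, ?_, hx⟩
          rw [mem_cutEdges_iff hpq]
          rw [hpq, Sym2.mem_iff] at hx
          refine ⟨trivial, fun h => ?_⟩
          rcases hx with rfl | rfl <;> tauto
        · exact .inl hxY
      have hp := hatt p (by simp [hpq])
      have hq := hatt q (by simp [hpq])
      rcases he with ⟨hpc, hqd⟩ | ⟨hpd, hqc⟩
      · exact ((ih p hp hpc).tail ⟨e, heg, hpq⟩).trans (hsame q b hq hb (hqd.trans hbd.symm))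
      · exact ((ih q hq hqc).tail ⟨e, heg, by rw [hpq, Sym2.eq_swap]⟩).trans
          (hsame p b hp hb (hpd.trans hbd.symm))

end Gluing

section Independence

variable {V E : Type} {ends : E → Sym2 V} {S R Y : Set V} {v y z z' : V} {Q k : ℕ}
  {P : Fin k → Set E}

lemma isBalancedSubpartitionAt_congr {ends' : E → Sym2 V} {u u' : V}
    (h : incEdges ends' u' = incEdges ends u) :
    IsBalancedSubpartitionAt ends' u' P ↔ IsBalancedSubpartitionAt ends u P := by
  simp only [IsBalancedSubpartitionAt, IsBalancedPartitionAt, IsSubpartitionAt, h]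

lemma IsBalancedSubpartitionAt.mono {u : V} {P' : Fin k → Set E}
    (h : IsBalancedSubpartitionAt ends u P) (hP : ∀ i, P' i ⊆ P i) :
    IsBalancedSubpartitionAt ends u P' := by
  obtain ⟨⟨h1, h2⟩, P₀, h3, h4⟩ := h
  exact ⟨⟨fun i => (hP i).trans (h1 i), fun i j hij => (h2 i j hij).mono (hP i) (hP j)⟩, P₀, h3,
    fun i => (hP i).trans (h4 i)⟩

lemma collapse_compl_eq {f : E} {a : V} (hf : f ∈ cutEdges ends Set.univ Y) (ha : a ∈ Y)
    (haf : a ∈ ends f) : collapse ends Yᶜ v z' f = s(a, v) := by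
  classical
  obtain ⟨b, hb⟩ := Sym2.mem_iff_exists.1 haf
  rw [mem_cutEdges_iff hb] at hf
  have hbY : b ∉ Y := by tauto
  simp [collapse_eq hb, ha, hbY]

lemma MinExtCex.not_crossing [Finite V] [Finite E] (hmin : MinExtCex Q k ends S R v P) {e : E}
    (he : ends e = s(z, z')) (hz : z ∉ S ∪ R) (hz' : z' ∉ S ∪ R) (hzY : z ∈ Y) (hzY' : z' ∉ Y)
    (hvY : v ∉ Y) (hyS : y ∈ S) (hy : y ∈ Y)
    (hcut : (cutEdges ends Set.univ Y).ncard = Q * k) : False := by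
  classical
  have hmin' := hmin
  obtain ⟨⟨hQ, hk, hSR, hS2, hconn, hR, hvS, hvl, hdeg, hP, hP2, hno⟩, -⟩ := hmin'
  have hecut : e ∈ cutEdges ends Set.univ Y := by
    rw [mem_cutEdges_iff he]
    tauto
  have hSe : ∀ s ∈ S, s ∉ ends e := by
    intro s hs h
    rw [he, Sym2.mem_iff] at h
    rcases h with rfl | rfl
    · exact hz (.inl hs)
    · exact hz' (.inl hs)
  have hzy : z ≠ y := fun h => hz (.inl (h ▸ hyS))
  have hzv : z' ≠ v := fun h => hz' (.inl (h ▸ hvS))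
  have hinc1 : ∀ u, u ∉ Y → incEdges (collapse ends Y y z) u = incEdges ends u :=
    fun u hu => incEdges_collapse_of_notMem hy hzY hu
  have hinc2 : ∀ u, u ∈ Y → incEdges (collapse ends Yᶜ v z') u = incEdges ends u :=
    fun u hu => incEdges_collapse_of_notMem hvY hzY' (not_not.2 hu)
  have hincy : incEdges (collapse ends Y y z) y = cutEdges ends Set.univ Y :=
    incEdges_collapse_self hy hzy
  have hincv : incEdges (collapse ends Yᶜ v z') v = cutEdges ends Set.univ Y := by
    rw [incEdges_collapse_self hvY hzv, cutEdges_compl]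
  obtain ⟨H₁, hdis₁, hconn₁, hbal₁, hext₁⟩ := hmin.exists_packing_collapse hy hyS hzY hvS hvY hcut
    hecut (hSe y hyS) (w := v) (.inl ⟨hvS, hvY⟩) (by rwa [deg, hinc1 v hvY])
    (not_isDiag_collapse_of_mem hy hzY hvY hvl)
    ((isBalancedSubpartitionAt_congr (hinc1 v hvY)).2 hP) hP2
  obtain ⟨-, P₂, hP₂, hsub⟩ := hbal₁ y (.inl (.inr rfl))
  rw [hincy] at hsub
  have hP₂' : IsBalancedSubpartitionAt (collapse ends Yᶜ v z') v P₂ :=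
    (isBalancedSubpartitionAt_congr (hincv.trans hincy.symm)).2
      ⟨hP₂.1, P₂, hP₂, fun _ => subset_rfl⟩
  obtain ⟨H₂, hdis₂, hconn₂, hbal₂, hext₂⟩ := hmin.exists_packing_collapse (Y := Yᶜ) hvY hvS hzY'
    hyS (not_not.2 hy) (by rwa [cutEdges_compl]) (by rwa [cutEdges_compl]) (hSe v hvS) (w := v)
    (.inr rfl) (by rwa [deg, hincv]) (not_isDiag_collapse_of_mem_self hvY hzv) hP₂' hP₂.2.2
  have hH12 : ∀ i, ∀ f ∈ H₁ i, f ∈ cutEdges ends Set.univ Y → f ∈ H₂ i :=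
    fun i f hf hfc => (hext₂ i).1 (hsub i ⟨hfc, hf⟩)
  have hglue2 : ∀ i A, ∀ a b, a ≠ v → b ≠ v → Reaches (collapse ends Yᶜ v z') (H₂ i) a b →
      Reaches ends (glue ends Y A (H₂ i)) a b := fun i A a b ha hb hab =>
    reaches_of_collapse_compl (reaches_avoiding (hext₂ i).2 ha hb hab)
  have hneY : ∀ a ∈ Y, a ≠ v := fun a ha h => hvY (h ▸ ha)
  have hatt : ∀ i, ∀ a ∈ Y, Attached ends Y (H₁ i) a →
      Reaches (collapse ends Yᶜ v z') (H₂ i) a v := by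
    rintro i a ha (h | ⟨f, hf, hfc, haf⟩)
    · exact absurd ha h
    · exact .single ⟨f, hH12 i f hf hfc, collapse_compl_eq hfc ha haf⟩
  have hB : ∀ i A, ∀ a ∈ Y, ∀ b ∈ Y, Attached ends Y (H₁ i) a → Attached ends Y (H₁ i) b →
      Reaches ends (glue ends Y A (H₂ i)) a b := fun i A a ha b hb h1 h2 =>
    hglue2 i A a b (hneY a ha) (hneY b hb) ((hatt i a ha h1).trans (hatt i b hb h2).symm)
  have hatty : ∀ i, ∃ a ∈ Y, Attached ends Y (H₁ i) a := by
    intro i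
    have h1 := hconn₁ i y (.inr rfl) v (.inl ⟨hvS, hvY⟩)
    rcases Relation.ReflTransGen.cases_head h1 with h | ⟨c, ⟨f, hf, hfc⟩, -⟩
    · exact absurd h (hneY y hy)
    · have hfcut : f ∈ cutEdges ends Set.univ Y := by
        rw [← hincy]
        simp [incEdges, hfc]
      obtain ⟨-, ⟨a, haf, ha⟩, -⟩ := id hfcut
      exact ⟨a, ha, .inr ⟨f, hf, hfcut, haf⟩⟩
  refine hno ⟨fun i => glue ends Y (H₁ i) (H₂ i), ?_, ?_, ?_, ?_⟩
  · intro i j hij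
    rw [Set.disjoint_left]
    rintro f (⟨h1, h2⟩ | ⟨h1, h2⟩) (⟨h3, h4⟩ | ⟨h3, h4⟩)
    · exact Set.disjoint_left.1 (hdis₁ i j hij) h1 h3
    · exact h2 h4
    · exact h4 h2
    · exact Set.disjoint_left.1 (hdis₂ i j hij) h1 h3
  · intro i
    obtain ⟨a, haY, ha⟩ := hatty i
    suffices ∀ s ∈ S, Reaches ends (glue ends Y (H₁ i) (H₂ i)) s a from
      fun s hs t ht => (this s hs).trans (this t ht).symm
    intro s hs
    by_cases hsY : s ∈ Y
    · exact hglue2 i _ s a (hneY s hsY) (hneY a haY)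
        ((hconn₂ i s (.inl ⟨hs, not_not.2 hsY⟩) v (.inr rfl)).trans (hatt i a haY ha).symm)
    · refine reaches_glue (z := z) hy subset_rfl (hB i _) (.inl hsY) ha ?_
      rw [if_neg hsY, if_pos haY]
      exact hconn₁ i s (.inl ⟨hs, hsY⟩) y (.inr rfl)
  · intro u hu
    by_cases huY : u ∈ Y
    · have h1 := hbal₂ u (by
        rcases hu with hu | hu
        · exact .inl (.inl ⟨hu, not_not.2 huY⟩)
        · exact .inr ⟨hu, not_not.2 huY⟩)
      rw [BalanceVertex, isBalancedSubpartitionAt_congr (hinc2 u huY), hinc2 u huY] at h1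
      refine h1.mono fun i f hf => ⟨hf.1, ?_⟩
      rcases hf.2 with ⟨h2, h3⟩ | ⟨h2, -⟩
      · refine hH12 i f h2 ⟨trivial, ⟨u, hf.1, huY⟩, ?_⟩
        push Not at h3
        exact h3
      · exact h2
    · have h1 := hbal₁ u (by
        rcases hu with hu | hu
        · exact .inl (.inl ⟨hu, huY⟩)
        · exact .inr ⟨hu, huY⟩)
      rw [BalanceVertex, isBalancedSubpartitionAt_congr (hinc1 u huY), hinc1 u huY] at h1
      refine h1.mono fun i f hf => ⟨hf.1, ?_⟩
      rcases hf.2 with ⟨h2, -⟩ | ⟨-, h2⟩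
      · exact h2
      · exact absurd (h2 u hf.1) huY
  · intro i
    refine ⟨fun f hf => .inl ⟨(hext₁ i).1 hf, fun h => hvY (h v (hP.1.1 i hf))⟩,
      not_isCutVertexOf ?_⟩
    intro f hf g hg a b ha hb hfa hgb
    have hkey : ∀ f ∈ glue ends Y (H₁ i) (H₂ i), ∀ a, a ≠ v → ends f = s(a, v) →
        Attached ends Y (H₁ i) a ∧ (if a ∈ Y then y else a) ≠ v ∧
          Reaches (collapse ends Y y z) (H₁ i) (if a ∈ Y then y else a) v := by
      intro f hf a ha hfa
      have hfH : f ∈ H₁ i := by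
        rcases hf with hf | hf
        · exact hf.1
        · exact absurd (hf.2 v (by simp [hfa])) hvY
      refine ⟨?_, ?_, .single ⟨f, hfH, ?_⟩⟩
      · by_cases haY : a ∈ Y
        · refine .inr ⟨f, hfH, ?_, by simp [hfa]⟩
          rw [mem_cutEdges_iff hfa]
          tauto
        · exact .inl haY
      · split_ifs
        · exact hneY y hy
        · exact ha
      · simp [collapse_eq hfa, hvY]
    obtain ⟨h1, h2, h3⟩ := hkey f hf a ha hfa
    obtain ⟨h4, h5, h6⟩ := hkey g hg b hb hgb
    refine (reaches_glue hy (Set.sep_subset (H₁ i) _) (hB i _) h1 h4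
      (reaches_avoiding (hext₁ i).2 h2 h5 (h3.trans h6.symm))).mono ?_
    rintro g (⟨⟨hg, hgv⟩, hgY⟩ | ⟨hg, hgY⟩)
    · exact ⟨.inl ⟨hg, hgY⟩, fun h => hgv (hinc1 v hvY ▸ h : g ∈ incEdges (collapse ends Y y z) v)⟩
    · exact ⟨.inr ⟨hg, hgY⟩, fun h => hvY (hgY v h)⟩

/-- In a minimal counterexample the vertices outside `S ∪ R` are independent. -/
theorem MinExtCex.eq_of_ends [Finite V] [Finite E] (hmin : MinExtCex Q k ends S R v P) {e : E}
    (he : ends e = s(z, z')) (hz : z ∉ S ∪ R) (hz' : z' ∉ S ∪ R) : z = z' := by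
  by_contra hzz
  obtain ⟨Y, hvY, ⟨y, hyS, hyY⟩, hcut, heY⟩ := hmin.exists_tight_cut he hzz hz hz'
  rw [mem_cutEdges_iff he] at heY
  by_cases hzY : z ∈ Y
  · exact hmin.not_crossing he hz hz' hzY (by tauto) hvY hyS hyY hcut
  · exact hmin.not_crossing (he.trans Sym2.eq_swap) hz' hz (by tauto) hzY hvY hyS hyY hcut

end Independence

section Assembly

variable {V E : Type} {ends : E → Sym2 V} {S R : Set V} {F : Set E} {v : V} {Q k : ℕ}
  {P : Fin k → Set E}

lemma isBalancedSubpartitionAt_of_sum_le [Finite E] {u : V} {A : Fin k → Set E} (hk : 0 < k)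
    (hA : IsSubpartitionAt ends u A)
    (hsum : ∑ i, (2 - (A i).ncard) ≤ (incEdges ends u \ ⋃ i, A i).ncard) :
    IsBalancedSubpartitionAt ends u A := by
  classical
  set D := incEdges ends u \ ⋃ i, A i with hD
  have := Fintype.ofFinite D
  obtain ⟨ψ⟩ : Nonempty ((Σ i, Fin (2 - (A i).ncard)) ↪ D) := by
    refine Function.Embedding.nonempty_of_card_le ?_
    rw [Fintype.card_sigma]
    simp only [Fintype.card_fin]
    rwa [← Nat.card_eq_fintype_card, Nat.card_coe_set_eq]
  let c : D → Fin k := Function.extend ψ Sigma.fst fun _ => ⟨0, hk⟩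
  have hc : ∀ i m, c (ψ ⟨i, m⟩) = i := fun i m => ψ.injective.extend_apply _ _ _
  have hDA : ∀ g : D, ∀ i, g.1 ∉ A i := fun g i h => g.2.2 (Set.mem_iUnion.2 ⟨i, h⟩)
  refine ⟨hA, fun i => A i ∪ {g | ∃ h : g ∈ D, c ⟨g, h⟩ = i}, ⟨⟨?_, ?_⟩, ?_, ?_⟩,
    fun i => Set.subset_union_left⟩
  · rintro i g (hg | ⟨hg, -⟩)
    · exact hA.1 i hg
    · exact hg.1
  · intro i j hij
    rw [Set.disjoint_left]
    rintro g (hg | ⟨hg, rfl⟩) (hg' | ⟨hg', rfl⟩)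
    · exact Set.disjoint_left.1 (hA.2 i j hij) hg hg'
    · exact hDA ⟨g, hg'⟩ i hg
    · exact hDA ⟨g, hg⟩ j hg'
    · exact hij rfl
  · refine subset_antisymm (Set.iUnion_subset ?_) fun g hg => ?_
    · rintro i g (hg | ⟨hg, -⟩)
      · exact hA.1 i hg
      · exact hg.1
    · by_cases h : g ∈ ⋃ i, A i
      · obtain ⟨i, hi⟩ := Set.mem_iUnion.1 h
        exact Set.mem_iUnion.2 ⟨i, .inl hi⟩
      · exact Set.mem_iUnion.2 ⟨_, .inr ⟨⟨hg, h⟩, rfl⟩⟩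
  · intro i
    have hdisj : Disjoint (A i) {g | ∃ h : g ∈ D, c ⟨g, h⟩ = i} :=
      Set.disjoint_left.2 fun g hg ⟨hg', _⟩ => hDA ⟨g, hg'⟩ i hg
    rw [Set.ncard_union_eq hdisj]
    have h1 : (Set.range fun m => (ψ ⟨i, m⟩).1).ncard = 2 - (A i).ncard := by
      rw [← Set.image_univ, Set.ncard_image_of_injective, Set.ncard_univ, Nat.card_fin]
      intro m m' h
      simpa using ψ.injective (Subtype.ext h)
    have h2 : (Set.range fun m => (ψ ⟨i, m⟩).1) ⊆ {g | ∃ h : g ∈ D, c ⟨g, h⟩ = i} := by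
      rintro _ ⟨m, rfl⟩
      exact ⟨(ψ ⟨i, m⟩).2, hc i m⟩
    have h3 := Set.ncard_le_ncard h2 (Set.toFinite _)
    omega

/-- In a minimal counterexample, each edge from `v` to a nonterminal `w` can be matched to its own
edge from `w` to a terminal. -/
lemma MinExtCex.exists_detour [Finite V] [Finite E] (hmin : MinExtCex Q k ends S R v P) :
    ∃ φ : E → E, (∀ e w, w ∉ S ∪ R → ends e = s(v, w) →
        ∃ t ∈ (S ∪ R) \ {v}, ends (φ e) = s(w, t)) ∧
      Set.InjOn φ {e | ∃ w, w ∉ S ∪ R ∧ ends e = s(v, w)} := by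
  classical
  have hmin' := hmin
  obtain ⟨⟨hQ, hk, hSR, hS2, hconn, hR, hvS, hvl, hdeg, hP, hP2, hno⟩, -⟩ := hmin'
  have hpos : 0 < Q * k := by positivity
  obtain ⟨e₀, -⟩ : (incEdges ends v).Nonempty := Set.nonempty_of_ncard_ne_zero (by
    unfold deg at hdeg
    omega)
  have : Nonempty E := ⟨e₀⟩
  obtain ⟨s, hs, hsv⟩ : ∃ s ∈ S, s ≠ v := by
    obtain ⟨a, b, ha, hb, hab⟩ := (Set.one_lt_ncard_iff (Set.toFinite _)).1 hS2
    by_cases h : a = v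
    · exact ⟨b, hb, fun h' => hab (h.trans h'.symm)⟩
    · exact ⟨a, ha, h⟩
  have hle : ∀ w, w ∉ S ∪ R → {e | ends e = s(v, w)}.ncard ≤
      {e | ∃ t ∈ (S ∪ R) \ {v}, ends e = s(w, t)}.ncard := by
    intro w hw
    have hsw : s ≠ w := fun h => hw (.inl (h ▸ hs))
    have h1 := (hconn v hvS s hs hsv.symm).le_cut (X := {v, w}) (.inl rfl) (by simp [hsv, hsw])
    have h2 : cutEdges ends Set.univ {v, w} ⊆ (incEdges ends v \ {e | ends e = s(v, w)}) ∪
        {e | ∃ t ∈ (S ∪ R) \ {v}, ends e = s(w, t)} := by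
      rintro e ⟨-, ⟨x, hx, hxX⟩, y, hy, hyX⟩
      have hxy : x ≠ y := fun h => hyX (h ▸ hxX)
      have he := (Sym2.mem_and_mem_iff hxy).1 ⟨hx, hy⟩
      simp only [Set.mem_insert_iff, Set.mem_singleton_iff, not_or] at hyX
      rcases hxX with rfl | rfl
      · refine .inl ⟨hx, fun h : ends e = _ => ?_⟩
        rw [he, Sym2.congr_right] at h
        exact hyX.2 h
      · refine .inr ⟨y, ⟨?_, hyX.1⟩, he⟩
        by_contra hyU
        exact hxy (hmin.eq_of_ends he hw hyU)
    have h3 := (Set.ncard_le_ncard h2 (Set.toFinite _)).trans (Set.ncard_union_le _ _)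
    have h4 : {e | ends e = s(v, w)} ⊆ incEdges ends v := fun e (he : ends e = _) => by
      simp [incEdges, he]
    have h5 := Set.ncard_sdiff_add_ncard_of_subset h4 (Set.toFinite _)
    unfold deg at hdeg
    omega
  have hex : ∀ w, ∃ φ : E → E, w ∉ S ∪ R → (∀ e, ends e = s(v, w) →
      ∃ t ∈ (S ∪ R) \ {v}, ends (φ e) = s(w, t)) ∧ Set.InjOn φ {e | ends e = s(v, w)} := by
    intro w
    by_cases hw : w ∈ S ∪ R
    · exact ⟨id, fun h => absurd hw h⟩
    · obtain ⟨φ, h1, h2⟩ := Set.Finite.exists_injOn_of_encard_le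
        (s := {e | ends e = s(v, w)}) (t := {e | ∃ t ∈ (S ∪ R) \ {v}, ends e = s(w, t)})
        (Set.toFinite _) (by
          rw [← Set.Finite.cast_ncard_eq (Set.toFinite _),
            ← Set.Finite.cast_ncard_eq (Set.toFinite _)]
          exact_mod_cast hle w hw)
      exact ⟨φ, fun _ => ⟨fun e he => h1 he, h2⟩⟩
  choose φ hφ using hex
  have : Nonempty V := ⟨v⟩
  choose! o ho using fun (e : E) (h : ∃ w, w ∉ S ∪ R ∧ ends e = s(v, w)) => h
  have hoe : ∀ e w, w ∉ S ∪ R → ends e = s(v, w) → o e = w := by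
    intro e w hw he
    have := (ho e ⟨w, hw, he⟩).2
    rwa [he, Sym2.congr_right, eq_comm] at this
  refine ⟨fun e => φ (o e) e, ?_, ?_⟩
  · intro e w hw he
    simp only [hoe e w hw he]
    exact (hφ w hw).1 e he
  · rintro e ⟨w, hw, he⟩ f ⟨w', hw', hf⟩ hef
    simp only [hoe e w hw he, hoe f w' hw' hf] at hef
    obtain ⟨t, ht, het⟩ := (hφ w hw).1 e he
    obtain ⟨t', ht', hft⟩ := (hφ w' hw').1 f hf
    rw [hef, hft, Sym2.eq_iff] at het
    rcases het with ⟨rfl, -⟩ | ⟨rfl, -⟩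
    · exact (hφ _ hw).2 he hf hef
    · exact absurd ht.1 hw'

/-- `k` disjoint subgraphs connecting the terminals other than `v` in `G - v - W`, with enough
room left to balance them. -/
lemma MinExtCex.exists_subgraphs [Finite V] [Finite E] (hmin : MinExtCex Q k ends S R v P)
    (hk : 8 ≤ k) (hFv : ∀ e ∈ F, v ∉ ends e)
    (hF : EdgeConnectedIn ends F ((S ∪ R) \ {v}) (11 * k / 2)) :
    ∃ H : Fin k → Set E, (∀ i, H i ⊆ F) ∧ PairwiseEdgeDisjoint H ∧
      (∀ i, ConnectsSet ends (H i) ((S ∪ R) \ {v})) ∧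
      ∀ u ∈ (S ∪ R) \ {v}, (S ∪ R) \ {v} = {u} ∨
        (∀ i, (incEdges ends u ∩ H i).Nonempty) ∧
          k ≤ {g | g ∈ F ∧ u ∈ ends g ∧ ∀ i, g ∉ H i}.ncard := by
  set T := (S ∪ R) \ {v} with hT
  by_cases h2 : 2 ≤ T.ncard
  · obtain ⟨H, hHF, hdis, hconn, hfree⟩ := exists_sparePacking (ends := ends)
      (F := {e ∈ F | ∃ x ∈ T, x ∈ ends e}) hk h2 (by
        rintro X ⟨⟨a, haT, haX⟩, b, hbT, hbX⟩
        refine ((hF a haT b hbT (fun h => hbX (h ▸ haX))).le_cut haX hbX).trans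
          (Set.ncard_le_ncard ?_ (Set.toFinite _))
        rintro e ⟨heF, ⟨x, hx, hxX⟩, y, hy, hyX⟩
        refine ⟨⟨heF, ?_⟩, ⟨x, hx, hxX⟩, y, hy, hyX⟩
        have hxy : x ≠ y := fun h => hyX (h ▸ hxX)
        have he := (Sym2.mem_and_mem_iff hxy).1 ⟨hx, hy⟩
        by_contra! hcon
        have hU : ∀ w ∈ ends e, w ∉ S ∪ R := fun w hw hwU =>
          hcon w ⟨hwU, fun h : w = v => hFv e heF (h ▸ hw)⟩ hw
        exact hxy (hmin.eq_of_ends he (hU x hx) (hU y hy))) fun e he => he.2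
    refine ⟨H, fun i e he => (hHF i he).1, hdis, hconn, fun u hu => .inr ⟨fun i => ?_, ?_⟩⟩
    · obtain ⟨t, ht, htu⟩ := Set.exists_ne_of_one_lt_ncard h2 u
      rcases Relation.ReflTransGen.cases_head (hconn i u hu t ht) with h | ⟨c, ⟨f, hf, hfc⟩, -⟩
      · exact absurd h.symm htu
      · exact ⟨f, by simp [incEdges, hfc], hf⟩
    · exact (hfree u hu).trans (Set.ncard_le_ncard (fun g hg => ⟨hg.1.1, hg.2⟩) (Set.toFinite _))
  · have hone : ∀ a ∈ T, ∀ b ∈ T, a = b := (Set.ncard_le_one (Set.toFinite _)).1 (by omega)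
    refine ⟨fun _ => ∅, fun _ => Set.empty_subset _, fun _ _ _ => disjoint_bot_left,
      fun i a ha b hb => hone a ha b hb ▸ .refl, fun u hu => .inl ?_⟩
    exact Set.eq_singleton_iff_unique_mem.2 ⟨hu, fun x hx => hone x hx u hu⟩

lemma MinExtCex.not_edgeConnectedIn [Finite V] [Finite E] (hmin : MinExtCex Q k ends S R v P)
    (hk : 8 ≤ k) (hFv : ∀ e ∈ F, v ∉ ends e)
    (hFW : ∀ e ∈ F, ∀ w ∈ neighbors ends v \ (S ∪ R), w ∉ ends e) :
    ¬ EdgeConnectedIn ends F ((S ∪ R) \ {v}) (11 * k / 2) := by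
  classical
  intro hF
  obtain ⟨H', hHF, hdis, hconn, hroom⟩ := hmin.exists_subgraphs hk hFv hF
  obtain ⟨φ, hφ, hinj⟩ := hmin.exists_detour
  have hmin' := hmin
  obtain ⟨⟨hQ, -, hSR, hS2, -, hR, hvS, hvl, hdeg, hP, hP2, hno⟩, -⟩ := hmin'
  set T := (S ∪ R) \ {v} with hT
  set D : Set E := {e | ∃ w, w ∉ S ∪ R ∧ ends e = s(v, w)} with hD
  let H : Fin k → Set E := fun i => H' i ∪ P i ∪ φ '' (P i ∩ D)
  have hPv : ∀ i, ∀ e ∈ P i, v ∈ ends e := hP.1.1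
  have hφv : ∀ e ∈ D, v ∉ ends (φ e) := by
    rintro e ⟨w, hw, he⟩ h
    obtain ⟨t, ht, het⟩ := hφ e w hw he
    rw [het, Sym2.mem_iff] at h
    rcases h with rfl | rfl
    · exact hw (.inl hvS)
    · exact ht.2 rfl
  have hφF : ∀ e ∈ D, φ e ∉ F := by
    rintro e ⟨w, hw, he⟩ h
    obtain ⟨t, ht, het⟩ := hφ e w hw he
    exact hFW _ h w ⟨⟨e, he⟩, hw⟩ (by simp [het])
  have hHdis : PairwiseEdgeDisjoint H := by
    intro i j hij
    rw [Set.disjoint_left]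
    rintro e ((h | h) | ⟨f, ⟨hf, hfD⟩, rfl⟩) ((h' | h') | ⟨g, ⟨hg, hgD⟩, hge⟩)
    · exact Set.disjoint_left.1 (hdis i j hij) h h'
    · exact hFv e (hHF i h) (hPv j e h')
    · exact hφF g hgD (hge ▸ hHF i h)
    · exact hFv e (hHF j h') (hPv i e h)
    · exact Set.disjoint_left.1 (hP.1.2 i j hij) h h'
    · exact hφv g hgD (hge ▸ hPv i e h)
    · exact hφF f hfD (hHF j h')
    · exact hφv f hfD (hPv j _ h')
    · exact Set.disjoint_left.1 (hP.1.2 i j hij) hf (hinj hgD hfD hge ▸ hg)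
  have hHv : ∀ i, ∀ e ∈ H i, v ∈ ends e → e ∈ P i := by
    rintro i e ((h | h) | ⟨f, ⟨hf, hfD⟩, rfl⟩) hv
    · exact absurd hv (hFv e (hHF i h))
    · exact h
    · exact absurd hv (hφv f hfD)
  have hT' : ∀ i, ∀ a ∈ T, ∀ b ∈ T, Reaches ends {e ∈ H i | v ∉ ends e} a b :=
    fun i a ha b hb => (hconn i a ha b hb).mono fun e he => ⟨.inl (.inl he), hFv e (hHF i he)⟩
  have hatt : ∀ i, ∀ e ∈ P i, ∀ a, ends e = s(v, a) → ∃ t ∈ T,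
      Reaches ends {e ∈ H i | v ∉ ends e} a t := by
    intro i e he a hea
    have hav : a ≠ v := by
      rintro rfl
      exact hvl e (hPv i e he) (by simp [hea])
    by_cases haU : a ∈ S ∪ R
    · exact ⟨a, ⟨haU, hav⟩, .refl⟩
    · obtain ⟨t, ht, het⟩ := hφ e a haU hea
      have heD : e ∈ D := ⟨a, haU, hea⟩
      exact ⟨t, ht, .single ⟨φ e, ⟨.inr ⟨e, ⟨he, heD⟩, rfl⟩, hφv e heD⟩, het⟩⟩
  refine hno ⟨H, hHdis, ?_, ?_, ?_⟩
  · intro i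
    obtain ⟨e, he⟩ : (P i).Nonempty := Set.nonempty_of_ncard_ne_zero (by have := hP2 i; omega)
    obtain ⟨a, hea⟩ := Sym2.mem_iff_exists.1 (hPv i e he)
    obtain ⟨t, ht, hat⟩ := hatt i e he a hea
    suffices ∀ s ∈ S, Reaches ends (H i) s t from fun s hs s' hs' => (this s hs).trans
      (this s' hs').symm
    intro s hs
    by_cases hsv : s = v
    · subst hsv
      exact .head ⟨e, .inl (.inr he), hea⟩ (hat.mono (Set.sep_subset _ _))
    · exact (hT' i s ⟨.inl hs, hsv⟩ t ht).mono (Set.sep_subset _ _)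
  · intro u hu
    by_cases huv : u = v
    · subst huv
      exact hP.mono fun i e he => hHv i e he.2 he.1
    have huT : u ∈ T := ⟨hu, huv⟩
    refine isBalancedSubpartitionAt_of_sum_le (by omega) ⟨fun i => Set.inter_subset_left,
      fun i j hij => (hHdis i j hij).mono Set.inter_subset_right Set.inter_subset_right⟩ ?_
    rcases hroom u huT with hTu | ⟨hne, hfree⟩
    · refine (Finset.sum_eq_zero fun i _ => ?_).le.trans (Nat.zero_le _)
      refine Nat.sub_eq_zero_of_le ((hP2 i).trans ?_)
      refine Set.ncard_le_ncard_of_injOn (fun e => if e ∈ D then φ e else e) ?_ ?_ (Set.toFinite _)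
      · intro e he
        obtain ⟨a, hea⟩ := Sym2.mem_iff_exists.1 (hPv i e he)
        by_cases heD : e ∈ D
        · simp only [heD, if_true]
          obtain ⟨w, hw, hew⟩ := id heD
          obtain ⟨t, ht, het⟩ := hφ e w hw hew
          rw [hTu] at ht
          obtain rfl : t = u := ht
          exact ⟨by simp [incEdges, het], .inr ⟨e, ⟨he, heD⟩, rfl⟩⟩
        · simp only [heD, if_false]
          have haT : a ∈ T := by
            refine ⟨by_contra fun h => heD ⟨a, h, hea⟩, ?_⟩
            rintro rfl
            exact hvl e (hPv i e he) (by simp [hea])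
          rw [hTu] at haT
          obtain rfl : a = u := haT
          exact ⟨by simp [incEdges, hea], .inl (.inr he)⟩
      · intro e he f hf hef
        by_cases heD : e ∈ D <;> by_cases hfD : f ∈ D <;>
          simp only [heD, hfD, if_true, if_false] at hef
        · exact hinj heD hfD hef
        · exact absurd (hef ▸ hPv i f hf) (hφv e heD)
        · exact absurd (hef ▸ hPv i e he) (hφv f hfD)
        · exact hef
    · have h1 : ∑ i : Fin k, (2 - (incEdges ends u ∩ H i).ncard) ≤ k := by
        refine (Finset.sum_le_sum (g := fun _ => 1) fun i _ => ?_).trans (by simp)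
        have : 0 < (incEdges ends u ∩ H i).ncard := (Set.ncard_pos (Set.toFinite _)).2
          ((hne i).mono (Set.inter_subset_inter_right _ fun e he => .inl (.inl he)))
        omega
      refine h1.trans (hfree.trans (Set.ncard_le_ncard ?_ (Set.toFinite _)))
      rintro g ⟨hgF, hgu, hgH⟩
      refine ⟨hgu, fun h => ?_⟩
      obtain ⟨i, -, (h | h) | ⟨f, ⟨-, hfD⟩, rfl⟩⟩ := Set.mem_iUnion.1 h
      · exact hgH i h
      · exact hFv g hgF (hPv i g h)
      · exact hφF f hfD hgF
  · intro i
    refine ⟨fun e he => .inl (.inr he), not_isCutVertexOf ?_⟩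
    intro e he f hf a b _ _ hea hfb
    rw [Sym2.eq_swap] at hea hfb
    obtain ⟨t, ht, hat⟩ := hatt i e (hHv i e he (by simp [hea])) a hea
    obtain ⟨t', ht', hbt⟩ := hatt i f (hHv i f hf (by simp [hfb])) b hfb
    exact (hat.trans (hT' i t ht t' ht')).trans hbt.symm

end Assembly

/-- Let `(G, S, R, v, P, Q, k)` be a minimal counterexample
to the Extension Theorem with `k ≥ 8`, `W` the set of neighbors of `v` not in
`S ∪ R`, and `G' = G − v − W`.  Then `(S ∪ R) − {v}` is not
`⌊5.5k⌋`-edge-connected in `G'`. -/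
theorem min_cex_Gprime_not_5point5k {V E : Type} [Fintype V] [Fintype E]
    (Q k : ℕ) (ends : E → Sym2 V) (S R : Set V) (v : V) (P : Fin k → Set E)
    (h : MinExtCex Q k ends S R v P) (hk8 : 8 ≤ k)
    (W : Set V) (hW : W = neighbors ends v \ (S ∪ R))
    (F : Set E) (hF : F = {e : E | ∀ x ∈ ends e, x ≠ v ∧ x ∉ W}) :
    ¬ EdgeConnectedIn ends F ((S ∪ R) \ {v}) (11 * k / 2) := by
  subst hF hW
  exact h.not_edgeConnectedIn hk8 (fun e he hv => (he v hv).1 rfl)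
    fun e he w hw hwe => (he w hwe).2 hw

end SteinerPacking
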